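/- arXiv:1912.03084 — 6 statements merged into one kernel-verified Lean document; each statement's English description precedes it below -/
import Mathlib

section
/- Let A : Ω → B(H) be strongly measurable with s ↦ ‖A(s)‖ essentially bounded. Then M_A is invertible in B(L²(Ω, μ; H)) if and only if A(s) is invertible in B(H) for a.e. s ∈ Ω and s ↦ ‖A(s)⁻¹‖ is essentially bounded; in that case, for every x ∈ L²(Ω, μ; H), ((M_A)⁻¹ x)(s) = A(s)⁻¹ x(s) for a.e. s ∈ Ω. -/
open MeasureTheory Filter Topology Set

noncomputable section

/-- A `C₀`-semigroup: a family `(T t)_{t ≥ 0}` of bounded operators with `T 0 = I`,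
`T (t+u) = T t ∘ T u` for `t, u ≥ 0`, and `t ↦ T t x` continuous on `[0, ∞)` for each `x`.
(Values at negative times are irrelevant.) -/
def IsC0Semigroup {K : Type*} [NormedAddCommGroup K] [NormedSpace ℂ K]
    (T : ℝ → K →L[ℂ] K) : Prop :=
  T 0 = 1 ∧
  (∀ t u : ℝ, 0 ≤ t → 0 ≤ u → T (t + u) = (T t).comp (T u)) ∧
  ∀ x : K, ContinuousOn (fun t => T t x) (Set.Ici (0 : ℝ))

/-- `R` is the resolvent of the (possibly unbounded) operator `B` at `lam`, i.e.
`lam ∈ ρ(B)` with `R = (lam - B)⁻¹` as a bounded operator. -/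
def ResolventAt {K : Type*} [NormedAddCommGroup K] [NormedSpace ℂ K]
    (B : K →ₗ.[ℂ] K) (lam : ℂ) (R : K →L[ℂ] K) : Prop :=
  (∀ y : K, ∃ hy : R y ∈ B.domain, lam • R y - B ⟨R y, hy⟩ = y) ∧
  ∀ x : B.domain, R (lam • (x : K) - B x) = x

/-- `B` is the generator of the semigroup `T`: its domain is the set of `x` for which
`t⁻¹ (T t x - x)` converges as `t → 0⁺`, and `B x` is that limit. -/
def IsGenerator {K : Type*} [NormedAddCommGroup K] [NormedSpace ℂ K]
    (T : ℝ → K →L[ℂ] K) (B : K →ₗ.[ℂ] K) : Prop :=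
  (∀ x : K, x ∈ B.domain ↔
    ∃ y : K, Tendsto (fun t : ℝ => t⁻¹ • (T t x - x)) (𝓝[>] (0:ℝ)) (𝓝 y)) ∧
  ∀ x : B.domain, Tendsto (fun t : ℝ => t⁻¹ • (T t (x : K) - (x : K))) (𝓝[>] (0:ℝ)) (𝓝 (B x))

/-- A bounded operator that is bounded below and has dense range is invertible. -/
lemma isUnit_of_norm_le_of_denseRange {E : Type*} [NormedAddCommGroup E] [NormedSpace ℂ E]
    [CompleteSpace E] (T : E →L[ℂ] E) (K : ℝ) (hK : ∀ x, ‖x‖ ≤ K * ‖T x‖)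
    (hd : DenseRange T) : IsUnit T := by
  have hanti : AntilipschitzWith K.toNNReal T :=
    AddMonoidHomClass.antilipschitz_of_bound T fun x => (hK x).trans <|
      mul_le_mul_of_nonneg_right (Real.le_coe_toNNReal K) (norm_nonneg _)
  rw [ContinuousLinearMap.isUnit_iff_bijective]
  refine ⟨hanti.injective, ?_⟩
  rw [← Set.range_eq_univ, ← (hanti.isClosed_range T.uniformContinuous).closure_eq]
  exact hd.closure_range

section

variable {Ω : Type*} [MeasurableSpace Ω] {μ : Measure Ω}
variable {H : Type*} [NormedAddCommGroup H] [InnerProductSpace ℂ H]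

lemma coeFn_mul_indicatorConstLp {A : Ω → H →L[ℂ] H} {MA : Lp H 2 μ →L[ℂ] Lp H 2 μ}
    (hMA : ∀ x : Lp H 2 μ, ⇑(MA x) =ᵐ[μ] fun s => A s (x s))
    {E : Set Ω} (hE : MeasurableSet E) (hμE : μ E ≠ ⊤) (h : H) :
    ⇑(MA (indicatorConstLp 2 hE hμE h)) =ᵐ[μ] E.indicator fun s => A s h := by
  filter_upwards [hMA (indicatorConstLp 2 hE hμE h),
    indicatorConstLp_coeFn (p := 2) (hs := hE) (hμs := hμE) (c := h)] with s h1 h2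
  rw [h1, h2]
  by_cases hs : s ∈ E <;> simp [hs]

lemma lintegral_enorm_sq_indicatorConstLp_le {A : Ω → H →L[ℂ] H} {MA : Lp H 2 μ →L[ℂ] Lp H 2 μ}
    (hMA : ∀ x : Lp H 2 μ, ⇑(MA x) =ᵐ[μ] fun s => A s (x s))
    (K : NNReal) (hK : ∀ x, ‖x‖ ≤ K * ‖MA x‖)
    {E : Set Ω} (hE : MeasurableSet E) (hμE : μ E ≠ ⊤) (h : H) :
    ∫⁻ _ in E, ‖h‖ₑ ^ 2 ∂μ ≤ ∫⁻ s in E, (K * ‖A s h‖ₑ) ^ 2 ∂μ := by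
  have key := hK (indicatorConstLp 2 hE hμE h)
  have key2 : ‖indicatorConstLp 2 hE hμE h‖ₑ ≤ K * ‖MA (indicatorConstLp 2 hE hμE h)‖ₑ := by
    simp only [enorm_eq_nnnorm]
    exact_mod_cast key
  rw [Lp.enorm_def, Lp.enorm_def,
    eLpNorm_congr_ae (coeFn_mul_indicatorConstLp hMA hE hμE h),
    eLpNorm_congr_ae (indicatorConstLp_coeFn (p := 2) (hs := hE) (hμs := hμE) (c := h)),
    eLpNorm_indicator_eq_eLpNorm_restrict hE, eLpNorm_indicator_eq_eLpNorm_restrict hE] at key2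
  have e (f : Ω → H) : eLpNorm f 2 (μ.restrict E) ^ 2 = ∫⁻ s in E, ‖f s‖ₑ ^ 2 ∂μ := by
    simpa using eLpNorm_nnreal_pow_eq_lintegral (f := f) (μ := μ.restrict E) (p := 2) (by simp)
  have key3 := pow_le_pow_left' key2 2
  rw [mul_pow, e, e, ← lintegral_const_mul' _ _ (by simp)] at key3
  simpa only [mul_pow] using key3

/-- If `M_A` is bounded below, then so is almost every `A s`, with the same constant. -/
lemma ae_norm_le_of_norm_le_multiplication [SigmaFinite μ] [TopologicalSpace.SeparableSpace H]
    {A : Ω → H →L[ℂ] H}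
    {MA : Lp H 2 μ →L[ℂ] Lp H 2 μ}
    (hMA : ∀ x : Lp H 2 μ, ⇑(MA x) =ᵐ[μ] fun s => A s (x s))
    (K : NNReal) (hK : ∀ x, ‖x‖ ≤ K * ‖MA x‖) :
    ∀ᵐ s ∂μ, ∀ h, ‖h‖ ≤ K * ‖A s h‖ := by
  have h1 (n : ℕ) : ∀ᵐ s ∂μ, ‖TopologicalSpace.denseSeq H n‖ ≤
      K * ‖A s (TopologicalSpace.denseSeq H n)‖ := by
    set h := TopologicalSpace.denseSeq H n
    have := ae_le_of_forall_setLIntegral_le_of_sigmaFinite (μ := μ) (f := fun _ => ‖h‖ₑ ^ 2)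
      (g := fun s => (K * ‖A s h‖ₑ) ^ 2) measurable_const
      fun E hE hμE => lintegral_enorm_sq_indicatorConstLp_le hMA K hK hE hμE.ne h
    filter_upwards [this] with s hs
    have hs' : ‖h‖ₑ ≤ K * ‖A s h‖ₑ := (ENNReal.pow_le_pow_left_iff two_ne_zero).1 hs
    simp only [enorm_eq_nnnorm] at hs'
    exact_mod_cast hs'
  filter_upwards [ae_all_iff.2 h1] with s hs h
  refine (TopologicalSpace.denseRange_denseSeq H).induction_on h ?_ hs
  exact isClosed_le continuous_norm (by fun_prop)

/-- If `M_A` is surjective, then almost every `A s` has dense range. -/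
lemma ae_denseRange_of_surjective_multiplication [SigmaFinite μ]
    [TopologicalSpace.SeparableSpace H] {A : Ω → H →L[ℂ] H} {MA : Lp H 2 μ →L[ℂ] Lp H 2 μ}
    (hMA : ∀ x : Lp H 2 μ, ⇑(MA x) =ᵐ[μ] fun s => A s (x s))
    (hsurj : Function.Surjective MA) :
    ∀ᵐ s ∂μ, DenseRange (A s) := by
  have h1 (n m : ℕ) : ∀ᵐ s ∂μ, s ∈ spanningSets μ m →
      TopologicalSpace.denseSeq H n ∈ Set.range (A s) := by
    have hE := measurableSet_spanningSets μ m
    have hμE := (measure_spanningSets_lt_top μ m).ne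
    obtain ⟨x, hx⟩ := hsurj (indicatorConstLp 2 hE hμE (TopologicalSpace.denseSeq H n))
    have h2 := hMA x
    rw [hx] at h2
    filter_upwards [h2, indicatorConstLp_coeFn (p := 2) (hs := hE) (hμs := hμE)
      (c := TopologicalSpace.denseSeq H n)] with s h3 h4 hs
    refine ⟨x s, ?_⟩
    rw [← h3, h4, Set.indicator_of_mem hs]
  filter_upwards [ae_all_iff.2 fun n => ae_all_iff.2 (h1 n)] with s hs
  refine (TopologicalSpace.denseRange_denseSeq H).mono ?_
  rintro _ ⟨n, rfl⟩
  exact hs n _ (mem_spanningSetsIndex μ s)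

/-- If almost every `A s` has dense range, then so has `M_A`. -/
lemma denseRange_multiplication_of_ae_denseRange [SigmaFinite μ] [CompleteSpace H]
    [TopologicalSpace.SeparableSpace H] {A : Ω → H →L[ℂ] H} {MA : Lp H 2 μ →L[ℂ] Lp H 2 μ}
    (hMA : ∀ x : Lp H 2 μ, ⇑(MA x) =ᵐ[μ] fun s => A s (x s))
    (hA : ∀ᵐ s ∂μ, DenseRange (A s)) : DenseRange MA := by
  have hbot : (MA.range : Submodule ℂ (Lp H 2 μ))ᗮ = ⊥ := by
    rw [Submodule.eq_bot_iff]
    intro y hy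
    rw [Submodule.mem_orthogonal] at hy
    have h1 (n : ℕ) : ∀ᵐ s ∂μ, inner ℂ (A s (TopologicalSpace.denseSeq H n)) (y s) = 0 := by
      set h := TopologicalSpace.denseSeq H n
      have hind (E : Set Ω) (hE : MeasurableSet E) (hμE : μ E < ⊤) :
          (fun s => inner ℂ (MA (indicatorConstLp 2 hE hμE.ne h) s) (y s)) =ᵐ[μ]
            E.indicator fun s => inner ℂ (A s h) (y s) := by
        filter_upwards [coeFn_mul_indicatorConstLp hMA hE hμE.ne h] with s hs
        rw [hs]
        by_cases hsE : s ∈ E <;> simp [hsE]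
      refine ae_eq_zero_of_forall_setIntegral_eq_of_sigmaFinite (fun E hE hμE => ?_)
        fun E hE hμE => ?_
      · rw [← integrable_indicator_iff hE]
        exact (L2.integrable_inner _ _).congr (hind E hE hμE)
      · rw [← integral_indicator hE, ← integral_congr_ae (hind E hE hμE), ← L2.inner_def]
        exact hy _ ⟨_, rfl⟩
    rw [Lp.eq_zero_iff_ae_eq_zero]
    filter_upwards [ae_all_iff.2 h1, hA] with s hs hd
    have h2 : ∀ h, inner ℂ (A s h) (y s) = 0 := fun h =>
      (TopologicalSpace.denseRange_denseSeq H).induction_on h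
        (isClosed_eq (by fun_prop) continuous_const) hs
    have h3 : inner ℂ (y s) (y s) = 0 :=
      hd.induction_on (p := fun z => inner ℂ z (y s) = 0) (y s)
        (isClosed_eq (by fun_prop) continuous_const) h2
    exact inner_self_eq_zero.1 h3
  rw [← Submodule.topologicalClosure_eq_top_iff,
    ← Submodule.dense_iff_topologicalClosure_eq_top] at hbot
  exact hbot

end

variable {Ω : Type*} [MeasurableSpace Ω] {μ : Measure Ω} [SigmaFinite μ]
variable {H : Type*} [NormedAddCommGroup H] [InnerProductSpace ℂ H] [CompleteSpace H]
  [TopologicalSpace.SeparableSpace H]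

/-- `M_A` is invertible in `B(L²(Ω, μ; H))` iff `A s` is invertible in `B(H)`
for a.e. `s` with essentially bounded inverses; in that case `((M_A)⁻¹ x)(s) = (A s)⁻¹ (x s)`
for a.e. `s`, for every `x`. -/
theorem multiplication_invertible (A : Ω → H →L[ℂ] H)
    (hmeas : ∀ x : H, StronglyMeasurable fun s => A s x)
    (C : ℝ) (hbdd : ∀ᵐ s ∂μ, ‖A s‖ ≤ C)
    (MA : Lp H 2 μ →L[ℂ] Lp H 2 μ)
    (hMA : ∀ x : Lp H 2 μ, ⇑(MA x) =ᵐ[μ] fun s => A s (x s)) :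
    (IsUnit MA ↔ ∃ (B : Ω → H →L[ℂ] H) (c : ℝ), ∀ᵐ s ∂μ,
        (A s).comp (B s) = 1 ∧ (B s).comp (A s) = 1 ∧ ‖B s‖ ≤ c) ∧
    ∀ N : Lp H 2 μ →L[ℂ] Lp H 2 μ, MA.comp N = 1 → N.comp MA = 1 →
      ∀ B : Ω → H →L[ℂ] H,
        (∀ᵐ s ∂μ, (A s).comp (B s) = 1 ∧ (B s).comp (A s) = 1) →
        ∀ x : Lp H 2 μ, ⇑(N x) =ᵐ[μ] fun s => B s (x s) := by
  refine ⟨⟨fun hu => ?_, ?_⟩, ?_⟩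
  · obtain ⟨u, rfl⟩ := hu
    have hinv (x : Lp H 2 μ) : (↑u⁻¹ : Lp H 2 μ →L[ℂ] Lp H 2 μ)
        ((u : Lp H 2 μ →L[ℂ] Lp H 2 μ) x) = x :=
      DFunLike.congr_fun u.inv_mul x
    have hbelow := ae_norm_le_of_norm_le_multiplication hMA
      ‖(↑u⁻¹ : Lp H 2 μ →L[ℂ] Lp H 2 μ)‖₊ fun x => by
        conv_lhs => rw [← hinv x]
        exact ContinuousLinearMap.le_opNorm _ _
    have hdense := ae_denseRange_of_surjective_multiplication hMA
      (ContinuousLinearMap.isUnit_iff_bijective.1 u.isUnit).2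
    have hex : ∀ᵐ s ∂μ, ∃ b : H →L[ℂ] H, (A s).comp b = 1 ∧ b.comp (A s) = 1 ∧
        ‖b‖ ≤ ‖(↑u⁻¹ : Lp H 2 μ →L[ℂ] Lp H 2 μ)‖ := by
      filter_upwards [hbelow, hdense] with s hs hd
      obtain ⟨v, hv⟩ := isUnit_of_norm_le_of_denseRange (A s) _ hs hd
      have hr : (A s).comp (↑v⁻¹ : H →L[ℂ] H) = 1 := hv ▸ v.mul_inv
      refine ⟨↑v⁻¹, hr, hv ▸ v.inv_mul,
        ContinuousLinearMap.opNorm_le_bound _ (norm_nonneg _) fun y => ?_⟩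
      have hy : A s ((↑v⁻¹ : H →L[ℂ] H) y) = y := DFunLike.congr_fun hr y
      simpa only [hy, coe_nnnorm] using hs ((↑v⁻¹ : H →L[ℂ] H) y)
    exact ⟨fun s => Classical.epsilon fun b : H →L[ℂ] H => (A s).comp b = 1 ∧
      b.comp (A s) = 1 ∧ ‖b‖ ≤ ‖(↑u⁻¹ : Lp H 2 μ →L[ℂ] Lp H 2 μ)‖, _,
      hex.mono fun s hs => Classical.epsilon_spec hs⟩
  · rintro ⟨B, c, hB⟩
    refine isUnit_of_norm_le_of_denseRange MA c (fun x => ?_)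
      (denseRange_multiplication_of_ae_denseRange hMA ?_)
    · refine Lp.norm_le_mul_norm_of_ae_le_mul ?_
      filter_upwards [hB, hMA x] with s hs hx
      have hBA : B s (A s (x s)) = x s := DFunLike.congr_fun hs.2.1 (x s)
      rw [hx]
      conv_lhs => rw [← hBA]
      exact (B s).le_of_opNorm_le hs.2.2 _
    · filter_upwards [hB] with s hs
      exact Function.Surjective.denseRange fun y => ⟨B s y, DFunLike.congr_fun hs.1 y⟩
  · intro N hN _ B hB x
    have h1 := hMA (N x)
    have h2 : MA (N x) = x := DFunLike.congr_fun hN x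
    rw [h2] at h1
    filter_upwards [h1, hB] with s hs hBs
    rw [hs]
    exact (DFunLike.congr_fun hBs.2 (N x s)).symm
end
end

section
/- Let A : Ω → B(H) be strongly measurable with s ↦ ‖A(s)‖ essentially bounded and let λ ∈ ℂ. Then λ ∉ σ(M_A) if and only if λ − A(s) is invertible in B(H) for a.e. s ∈ Ω and esssup_{s∈Ω} ‖(λ − A(s))⁻¹‖ < ∞; in that case, for every x ∈ L²(Ω, μ; H), ((λ − M_A)⁻¹ x)(s) = (λ − A(s))⁻¹ x(s) for a.e. s ∈ Ω. -/
open MeasureTheory Filter Topology Set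

noncomputable section

variable {Ω : Type*} [MeasurableSpace Ω] {μ : Measure Ω} [SigmaFinite μ]
variable {H : Type*} [NormedAddCommGroup H] [InnerProductSpace ℂ H] [CompleteSpace H]
  [TopologicalSpace.SeparableSpace H]

omit [SigmaFinite μ] [CompleteSpace H] [TopologicalSpace.SeparableSpace H] in
/-- On a simple function `h` supported on `E`, a multiplication operator acts pointwise. -/
theorem multiplication_indicatorConstLp {T : Ω → H →L[ℂ] H} {M : Lp H 2 μ →L[ℂ] Lp H 2 μ}
    (hM : ∀ x : Lp H 2 μ, ⇑(M x) =ᵐ[μ] fun s => T s (x s))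
    {E : Set Ω} (hE : MeasurableSet E) (hμE : μ E ≠ ⊤) (h : H) :
    ⇑(M (indicatorConstLp 2 hE hμE h)) =ᵐ[μ] E.indicator fun s => T s h := by
  filter_upwards [hM (indicatorConstLp 2 hE hμE h),
    indicatorConstLp_coeFn (p := 2) (hs := hE) (hμs := hμE) (c := h)] with s hs hs'
  rw [hs, hs']
  by_cases hsE : s ∈ E <;> simp [hsE]

/-- A multiplication operator with a left inverse `N` has fibres bounded below by `‖N‖⁻¹`. -/
theorem ae_norm_le_of_multiplication_leftInverse {T : Ω → H →L[ℂ] H}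
    (hT : ∀ h : H, StronglyMeasurable fun s => T s h) {M N : Lp H 2 μ →L[ℂ] Lp H 2 μ}
    (hM : ∀ x : Lp H 2 μ, ⇑(M x) =ᵐ[μ] fun s => T s (x s)) (hN : ∀ x, N (M x) = x) :
    ∀ᵐ s ∂μ, ∀ h : H, ‖h‖ ≤ ‖N‖ * ‖T s h‖ := by
  have key (h : H) : ∀ᵐ s ∂μ, ‖h‖ ≤ ‖N‖ * ‖T s h‖ := by
    have hle : (fun _ : Ω => ‖h‖ₑ ^ 2) ≤ᵐ[μ] fun s => (‖N‖ₑ * ‖T s h‖ₑ) ^ 2 := by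
      refine ae_le_of_forall_setLIntegral_le_of_sigmaFinite measurable_const
        fun E hE hμE => ?_
      set x := indicatorConstLp 2 hE hμE.ne h
      have hx : ‖x‖ₑ ≤ ‖N‖ₑ * ‖M x‖ₑ := by
        simpa only [hN] using N.le_opENorm (M x)
      have h1 : ‖x‖ₑ ^ 2 = ∫⁻ _ in E, ‖h‖ₑ ^ 2 ∂μ := by
        rw [Lp.enorm_def, eLpNorm_congr_ae indicatorConstLp_coeFn,
          eLpNorm_indicator_eq_eLpNorm_restrict hE]
        simpa using eLpNorm_nnreal_pow_eq_lintegral (p := 2) (μ := μ.restrict E)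
          (f := fun _ => h) two_ne_zero
      have h2 : ‖M x‖ₑ ^ 2 = ∫⁻ s in E, ‖T s h‖ₑ ^ 2 ∂μ := by
        rw [Lp.enorm_def, eLpNorm_congr_ae (multiplication_indicatorConstLp hM hE hμE.ne h),
          eLpNorm_indicator_eq_eLpNorm_restrict hE]
        simpa using eLpNorm_nnreal_pow_eq_lintegral (p := 2) (μ := μ.restrict E)
          (f := fun s => T s h) two_ne_zero
      simp_rw [mul_pow]
      rw [lintegral_const_mul _ ((hT h).enorm.pow_const 2), ← h1, ← h2, ← mul_pow]
      gcongr
    filter_upwards [hle] with s hs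
    have := (ENNReal.pow_le_pow_left_iff two_ne_zero).1 hs
    rw [← enorm_norm (T s h), ← enorm_norm N, ← enorm_mul, enorm_le_iff_norm_le] at this
    simpa using this
  obtain ⟨D, hDc, hD⟩ := TopologicalSpace.exists_countable_dense H
  filter_upwards [(ae_ball_iff hDc).2 fun h _ => key h] with s hs h
  have hcl : IsClosed {h : H | ‖h‖ ≤ ‖N‖ * ‖T s h‖} :=
    isClosed_le (by fun_prop) (by fun_prop)
  exact hcl.closure_subset_iff.2 hs (hD h)

omit [CompleteSpace H] in
/-- The fibres of a multiplication operator with a right inverse have dense range. -/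
theorem ae_denseRange_of_multiplication_rightInverse {T : Ω → H →L[ℂ] H}
    {M N : Lp H 2 μ →L[ℂ] Lp H 2 μ}
    (hM : ∀ x : Lp H 2 μ, ⇑(M x) =ᵐ[μ] fun s => T s (x s)) (hN : ∀ x, M (N x) = x) :
    ∀ᵐ s ∂μ, DenseRange (T s) := by
  obtain ⟨D, hDc, hD⟩ := TopologicalSpace.exists_countable_dense H
  have key (h : H) : ∀ᵐ s ∂μ, h ∈ Set.range (T s) := by
    have hn (n : ℕ) : ∀ᵐ s ∂μ, s ∈ spanningSets μ n → h ∈ Set.range (T s) := by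
      have hE := measurableSet_spanningSets μ n
      have hμE := (measure_spanningSets_lt_top μ n).ne
      filter_upwards [hM (N (indicatorConstLp 2 hE hμE h)),
        indicatorConstLp_coeFn (p := 2) (hs := hE) (hμs := hμE) (c := h)] with s hs hs' hsE
      rw [hN, hs', Set.indicator_of_mem hsE] at hs
      exact ⟨_, hs.symm⟩
    filter_upwards [ae_all_iff.2 hn] with s hs
    exact hs _ (mem_spanningSetsIndex μ s)
  filter_upwards [(ae_ball_iff hDc).2 fun h _ => key h] with s hs
  exact hD.mono hs

/-- The fibres of an invertible multiplication operator are invertible, with uniformly bounded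
inverses. -/
theorem exists_ae_inverse_of_isUnit_multiplication {T : Ω → H →L[ℂ] H}
    (hT : ∀ h : H, StronglyMeasurable fun s => T s h) {M : Lp H 2 μ →L[ℂ] Lp H 2 μ}
    (hM : ∀ x : Lp H 2 μ, ⇑(M x) =ᵐ[μ] fun s => T s (x s)) (hu : IsUnit M) :
    ∃ (B : Ω → H →L[ℂ] H) (c : ℝ), ∀ᵐ s ∂μ,
      (T s).comp (B s) = 1 ∧ (B s).comp (T s) = 1 ∧ ‖B s‖ ≤ c := by
  obtain ⟨N, hMN, hNM⟩ := isUnit_iff_exists.1 hu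
  refine ⟨fun s => Ring.inverse (T s), ‖N‖, ?_⟩
  filter_upwards [ae_norm_le_of_multiplication_leftInverse hT hM (N := N)
      fun x => DFunLike.congr_fun hNM x,
    ae_denseRange_of_multiplication_rightInverse hM (N := N)
      fun x => DFunLike.congr_fun hMN x] with s hbelow hdense
  have hanti : AntilipschitzWith ‖N‖₊ (T s) := (T s).antilipschitz_of_bound hbelow
  have hunit : IsUnit (T s) := by
    refine ContinuousLinearMap.isUnit_iff_bijective.2 ⟨hanti.injective, ?_⟩
    rw [← Set.range_eq_univ, ← (hanti.isClosed_range (T s).uniformContinuous).closure_eq]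
    exact hdense.closure_range
  have hr : (T s).comp (Ring.inverse (T s)) = 1 := Ring.mul_inverse_cancel _ hunit
  refine ⟨hr, Ring.inverse_mul_cancel _ hunit, ?_⟩
  refine ContinuousLinearMap.opNorm_le_bound _ (norm_nonneg _) fun h => ?_
  have := hbelow (Ring.inverse (T s) h)
  rwa [← ContinuousLinearMap.comp_apply, hr] at this

omit [CompleteSpace H] in
/-- If the fibres of a multiplication operator are surjective, then its range has trivial
orthogonal complement. -/
theorem orthogonal_range_multiplication_eq_bot {T : Ω → H →L[ℂ] H}
    {M : Lp H 2 μ →L[ℂ] Lp H 2 μ}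
    (hM : ∀ x : Lp H 2 μ, ⇑(M x) =ᵐ[μ] fun s => T s (x s))
    (hsurj : ∀ᵐ s ∂μ, Function.Surjective (T s)) :
    (LinearMap.range (M : Lp H 2 μ →ₗ[ℂ] Lp H 2 μ))ᗮ = ⊥ := by
  refine (Submodule.eq_bot_iff _).2 fun x hx => ?_
  have key (h : H) : ∀ᵐ s ∂μ, inner ℂ (x s) (T s h) = 0 := by
    have hae {E : Set Ω} (hE : MeasurableSet E) (hμE : μ E < ⊤) :
        (fun s => inner ℂ (x s) (M (indicatorConstLp 2 hE hμE.ne h) s)) =ᵐ[μ]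
          E.indicator fun s => inner ℂ (x s) (T s h) := by
      filter_upwards [multiplication_indicatorConstLp hM hE hμE.ne h] with s hs
      rw [hs]
      by_cases hsE : s ∈ E <;> simp [hsE]
    refine ae_eq_zero_of_forall_setIntegral_eq_of_sigmaFinite (fun E hE hμE => ?_)
      fun E hE hμE => ?_
    · rw [← integrable_indicator_iff hE]
      exact (L2.integrable_inner x _).congr (hae hE hμE)
    · rw [← integral_indicator hE, ← integral_congr_ae (hae hE hμE), ← L2.inner_def]
      exact Submodule.inner_left_of_mem_orthogonal (LinearMap.mem_range_self _ _) hx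
  obtain ⟨D, hDc, hD⟩ := TopologicalSpace.exists_countable_dense H
  rw [Lp.eq_zero_iff_ae_eq_zero]
  filter_upwards [(ae_ball_iff hDc).2 fun h _ => key h, hsurj] with s hs hsurj
  have hcl : IsClosed {h : H | inner ℂ (x s) (T s h) = 0} :=
    isClosed_eq (by fun_prop) continuous_const
  obtain ⟨h, hh⟩ := hsurj (x s)
  have h0 : inner ℂ (x s) (T s h) = 0 := hcl.closure_subset_iff.2 hs (hD h)
  rwa [hh, inner_self_eq_zero] at h0

/-- A multiplication operator whose fibres have uniformly bounded inverses is invertible. -/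
theorem isUnit_multiplication_of_ae_inverse {T : Ω → H →L[ℂ] H}
    {M : Lp H 2 μ →L[ℂ] Lp H 2 μ}
    (hM : ∀ x : Lp H 2 μ, ⇑(M x) =ᵐ[μ] fun s => T s (x s)) {B : Ω → H →L[ℂ] H} {c : ℝ}
    (hB : ∀ᵐ s ∂μ, (T s).comp (B s) = 1 ∧ (B s).comp (T s) = 1 ∧ ‖B s‖ ≤ c) :
    IsUnit M := by
  have hbelow (x : Lp H 2 μ) : ‖x‖ ≤ (c.toNNReal : ℝ) * ‖M x‖ := by
    refine Lp.norm_le_mul_norm_of_ae_le_mul ?_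
    filter_upwards [hM x, hB] with s hs ⟨_, hl, hc⟩
    rw [hs]
    calc ‖x s‖ = ‖B s (T s (x s))‖ := by rw [← ContinuousLinearMap.comp_apply, hl]; rfl
      _ ≤ (c.toNNReal : ℝ) * ‖T s (x s)‖ :=
        (B s).le_of_opNorm_le (hc.trans (Real.le_coe_toNNReal c)) _
  have hanti : AntilipschitzWith c.toNNReal M := M.antilipschitz_of_bound hbelow
  refine ContinuousLinearMap.isUnit_iff_bijective.2 ⟨hanti.injective, ?_⟩
  have hclosed : IsClosed (LinearMap.range (M : Lp H 2 μ →ₗ[ℂ] Lp H 2 μ) : Set (Lp H 2 μ)) :=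
    hanti.isClosed_range M.uniformContinuous
  have hbot := orthogonal_range_multiplication_eq_bot hM <| by
    filter_upwards [hB] with s hs h
    exact ⟨B s h, DFunLike.congr_fun hs.1 h⟩
  have htop := (Submodule.topologicalClosure_eq_top_iff).2 hbot
  rw [hclosed.submodule_topologicalClosure_eq] at htop
  exact LinearMap.range_eq_top.1 htop

/-- `lam ∉ σ(M_A)` iff `lam - A s` is invertible in `B(H)` for a.e. `s` with
essentially bounded inverses; in that case `((lam - M_A)⁻¹ x)(s) = (lam - A s)⁻¹ (x s)` a.e. -/
theorem multiplication_spectrum (A : Ω → H →L[ℂ] H)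
    (hmeas : ∀ x : H, StronglyMeasurable fun s => A s x)
    (C : ℝ) (hbdd : ∀ᵐ s ∂μ, ‖A s‖ ≤ C)
    (MA : Lp H 2 μ →L[ℂ] Lp H 2 μ)
    (hMA : ∀ x : Lp H 2 μ, ⇑(MA x) =ᵐ[μ] fun s => A s (x s))
    (lam : ℂ) :
    (lam ∉ spectrum ℂ MA ↔ ∃ (B : Ω → H →L[ℂ] H) (c : ℝ), ∀ᵐ s ∂μ,
        (lam • (1 : H →L[ℂ] H) - A s).comp (B s) = 1 ∧
        (B s).comp (lam • (1 : H →L[ℂ] H) - A s) = 1 ∧ ‖B s‖ ≤ c) ∧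
    ∀ N : Lp H 2 μ →L[ℂ] Lp H 2 μ,
      (lam • (1 : Lp H 2 μ →L[ℂ] Lp H 2 μ) - MA).comp N = 1 →
      N.comp (lam • (1 : Lp H 2 μ →L[ℂ] Lp H 2 μ) - MA) = 1 →
      ∀ B : Ω → H →L[ℂ] H,
        (∀ᵐ s ∂μ, (lam • (1 : H →L[ℂ] H) - A s).comp (B s) = 1 ∧
          (B s).comp (lam • (1 : H →L[ℂ] H) - A s) = 1) →
        ∀ x : Lp H 2 μ, ⇑(N x) =ᵐ[μ] fun s => B s (x s) := by
  have hT (h : H) : StronglyMeasurable fun s => (lam • (1 : H →L[ℂ] H) - A s) h :=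
    stronglyMeasurable_const.sub (hmeas h)
  have hM (x : Lp H 2 μ) : ⇑((lam • (1 : Lp H 2 μ →L[ℂ] Lp H 2 μ) - MA) x) =ᵐ[μ]
      fun s => (lam • (1 : H →L[ℂ] H) - A s) (x s) := by
    filter_upwards [Lp.coeFn_sub (lam • x) (MA x), Lp.coeFn_smul lam x, hMA x] with s h1 h2 h3
    simpa [h2, h3] using h1
  refine ⟨?_, fun N hMN _ B hB x => ?_⟩
  · rw [spectrum.notMem_iff, Algebra.algebraMap_eq_smul_one]
    exact ⟨exists_ae_inverse_of_isUnit_multiplication hT hM,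
      fun ⟨_, _, hB⟩ => isUnit_multiplication_of_ae_inverse hM hB⟩
  · have hx := hM (N x)
    rw [← ContinuousLinearMap.comp_apply, hMN] at hx
    filter_upwards [hx, hB] with s hs hBs
    exact (DFunLike.congr_fun hBs.2 (N x s)).symm.trans (congrArg (B s) hs.symm)
end
end

section
/- Assume all singletons in Ω are measurable and that every atom G of μ has the form {x} ∪ N for some x ∈ G with μ({x}) = μ(G) and some μ-null set N (as holds for Radon measures). Let A : Ω → B(H) be strongly measurable with s ↦ ‖A(s)‖ essentially bounded. Then M_A is a compact operator on L²(Ω, μ; H) if and only if there is a finite or countably infinite set of distinct points s₁, s₂, … in Ω such that μ({s_i}) > 0 for every i, A(s_i) is a nonzero compact operator for every i, ‖A(s_i)‖ → 0 as i → ∞ when the set is infinite, and A(s) = 0 for a.e. s ∈ Ω \ {s₁, s₂, …}. -/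
open MeasureTheory Filter Topology Set

noncomputable section

section

variable {Ω : Type*} [MeasurableSpace Ω] {μ : Measure Ω}
variable {H : Type*} [NormedAddCommGroup H] [InnerProductSpace ℂ H]

/-- A property that holds almost everywhere holds at every point of positive measure. -/
lemma MeasureTheory.Measure.holds_of_ae_of_measure_singleton_pos {p : Ω → Prop}
    (h : ∀ᵐ s ∂μ, p s) {s : Ω} (hs : 0 < μ {s}) : p s := by
  by_contra hp
  exact hs.ne' (measure_mono_null (singleton_subset_iff.2 hp) h)

/-- The continuous linear map `x ↦ 1_B x` from `H` to `L²(μ; H)`. -/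
def indicatorConstCLM (B : Set Ω) (hB : MeasurableSet B) (hμB : μ B ≠ ⊤) :
    H →L[ℂ] Lp H 2 μ :=
  LinearMap.mkContinuous
    { toFun := fun x => indicatorConstLp 2 hB hμB x
      map_add' := fun _ _ => indicatorConstLp_add.symm
      map_smul' := fun c x => by
        apply Lp.ext
        filter_upwards [indicatorConstLp_coeFn (p := 2) (hs := hB) (hμs := hμB) (c := c • x),
          indicatorConstLp_coeFn (p := 2) (hs := hB) (hμs := hμB) (c := x),
          Lp.coeFn_smul c (indicatorConstLp 2 hB hμB x)] with s h₁ h₂ h₃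
        simp only [RingHom.id_apply]
        rw [h₁, h₃, Pi.smul_apply, h₂, indicator_const_smul_apply] }
    (μ.real B ^ (1 / (2 : ENNReal).toReal))
    fun x => by
      rw [mul_comm]
      exact norm_indicatorConstLp_le (hs := hB) (hμs := hμB)

lemma indicatorConstCLM_apply (B : Set Ω) (hB : MeasurableSet B) (hμB : μ B ≠ ⊤) (x : H) :
    indicatorConstCLM B hB hμB x = indicatorConstLp 2 hB hμB x := rfl

/-- Evaluation of `L²` functions at a point of positive finite measure. -/
def evalAtomCLM [MeasurableSingletonClass Ω] (s : Ω) (hs : 0 < μ {s}) (hs' : μ {s} ≠ ⊤) :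
    Lp H 2 μ →L[ℂ] H :=
  LinearMap.mkContinuous
    { toFun := fun f => f s
      map_add' := fun f g => Measure.holds_of_ae_of_measure_singleton_pos (Lp.coeFn_add f g) hs
      map_smul' := fun c f =>
        Measure.holds_of_ae_of_measure_singleton_pos (Lp.coeFn_smul c f) hs }
    (μ.real {s} ^ (1 / (2 : ENNReal).toReal))⁻¹
    fun f => by
      have hpos : 0 < μ.real {s} ^ (1 / (2 : ENNReal).toReal) :=
        Real.rpow_pos_of_pos (ENNReal.toReal_pos hs.ne' hs') _
      rw [inv_mul_eq_div, le_div_iff₀ hpos]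
      have := Lp.norm_le_norm_of_ae_le
        (f := indicatorConstLp 2 (measurableSet_singleton s) hs' (f s)) (g := f) (by
          filter_upwards [indicatorConstLp_coeFn (p := 2) (hs := measurableSet_singleton s)
            (hμs := hs') (c := f s)] with t ht
          rw [ht]
          by_cases hts : t = s
          · simp [hts]
          · simp [hts])
      rwa [norm_indicatorConstLp (by simp) (by simp)] at this

lemma evalAtomCLM_apply [MeasurableSingletonClass Ω] (s : Ω) (hs : 0 < μ {s})
    (hs' : μ {s} ≠ ⊤) (f : Lp H 2 μ) : evalAtomCLM s hs hs' f = f s := rfl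

/-- A compact operator cannot map a bounded sequence to a uniformly separated one. -/
lemma IsCompactOperator.exists_dist_lt {E F : Type*} [NormedAddCommGroup E] [NormedSpace ℂ E]
    [NormedAddCommGroup F] [NormedSpace ℂ F] {T : E →L[ℂ] F} (hT : IsCompactOperator ⇑T)
    {K ε : ℝ} (hε : 0 < ε) {f : ℕ → E} (hf : ∀ n, ‖f n‖ ≤ K) :
    ∃ m n, m ≠ n ∧ dist (T (f m)) (T (f n)) < ε := by
  obtain ⟨Z, hZ, hZ'⟩ :=
    IsCompactOperator.image_closedBall_subset_compact (f := (T : E →ₗ[ℂ] F)) hT K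
  obtain ⟨a, -, φ, hφ, hlim⟩ := hZ.tendsto_subseq (x := fun n => T (f n))
    fun n => hZ' ⟨f n, by simpa using hf n, rfl⟩
  obtain ⟨N, hN⟩ := Metric.cauchySeq_iff.1 hlim.cauchySeq ε hε
  exact ⟨φ N, φ (N + 1), (hφ N.lt_succ_self).ne, hN N le_rfl (N + 1) N.le_succ⟩

/-- If a multiplication operator is compact, then the multiplier cannot be bounded below along
a bounded sequence of vectors on infinitely many disjoint sets of positive measure. -/
lemma not_isCompactOperator_of_disjoint {A : Ω → H →L[ℂ] H} {T : Lp H 2 μ →L[ℂ] Lp H 2 μ}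
    (hA : ∀ x : Lp H 2 μ, ⇑(T x) =ᵐ[μ] fun s => A s (x s))
    {B : ℕ → Set Ω} (hB : ∀ n, MeasurableSet (B n)) (hB0 : ∀ n, μ (B n) ≠ 0)
    (hBtop : ∀ n, μ (B n) ≠ ⊤) (hdisj : Pairwise (Function.onFun Disjoint B))
    {x : ℕ → H} {K ε : ℝ} (hε : 0 < ε) (hx : ∀ n, ‖x n‖ ≤ K)
    (hle : ∀ n, ∀ s ∈ B n, ε ≤ ‖A s (x n)‖) : ¬ IsCompactOperator ⇑T := by
  intro hT
  set r : ℕ → ℝ := fun n => μ.real (B n) ^ (1 / (2 : ENNReal).toReal) with hr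
  have hrpos (n) : 0 < r n := Real.rpow_pos_of_pos (ENNReal.toReal_pos (hB0 n) (hBtop n)) _
  obtain ⟨m, n, hmn, hlt⟩ := hT.exists_dist_lt (K := K) hε
    (f := fun n => indicatorConstLp 2 (hB n) (hBtop n) (((r n)⁻¹ : ℂ) • x n)) (fun n => by
      rw [norm_indicatorConstLp (by simp) (by simp), norm_smul]
      change _ * _ * r n ≤ K
      rw [norm_inv, Complex.norm_of_nonneg (hrpos n).le, mul_right_comm,
        inv_mul_cancel₀ (hrpos n).ne', one_mul]
      exact hx n)
  refine hlt.not_ge ?_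
  rw [dist_eq_norm, ← map_sub]
  set u := indicatorConstLp 2 (hB m) (hBtop m) (((r m)⁻¹ : ℂ) • x m)
  set v := indicatorConstLp 2 (hB n) (hBtop n) (((r n)⁻¹ : ℂ) • x n)
  have key := Lp.norm_le_norm_of_ae_le
    (f := indicatorConstLp 2 (hB m) (hBtop m) ((r m)⁻¹ * ε)) (g := T (u - v)) (by
      filter_upwards [hA (u - v), Lp.coeFn_sub u v,
        indicatorConstLp_coeFn (p := 2) (hs := hB m) (hμs := hBtop m) (c := (r m)⁻¹ * ε),
        indicatorConstLp_coeFn (p := 2) (hs := hB m) (hμs := hBtop m)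
          (c := ((r m)⁻¹ : ℂ) • x m),
        indicatorConstLp_coeFn (p := 2) (hs := hB n) (hμs := hBtop n)
          (c := ((r n)⁻¹ : ℂ) • x n)] with s h₁ h₂ h₃ h₄ h₅
      rw [h₁, h₂, h₃, Pi.sub_apply, h₄, h₅]
      by_cases hs : s ∈ B m
      · have hs' : s ∉ B n := fun h => Set.disjoint_left.1 (hdisj hmn) hs h
        have hr0 := inv_pos.2 (hrpos m)
        rw [indicator_of_mem hs, indicator_of_mem hs, indicator_of_notMem hs', sub_zero, map_smul,
          norm_smul, norm_inv, Complex.norm_of_nonneg (hrpos m).le,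
          Real.norm_of_nonneg (by positivity)]
        exact mul_le_mul_of_nonneg_left (hle m s hs) hr0.le
      · rw [indicator_of_notMem hs]
        simp)
  rw [norm_indicatorConstLp (by simp) (by simp)] at key
  change _ * r m ≤ _ at key
  have hr0 := inv_pos.2 (hrpos m)
  rwa [Real.norm_of_nonneg (by positivity), mul_right_comm, inv_mul_cancel₀ (hrpos m).ne',
    one_mul] at key

/-- A set of positive measure whose subsets of positive measure can all be split contains
infinitely many disjoint sets of positive measure. -/
lemma exists_seq_disjoint_of_forall_split {G : Set Ω} (hG : MeasurableSet G) (hG0 : μ G ≠ 0)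
    (hsplit : ∀ E ⊆ G, MeasurableSet E → μ E ≠ 0 →
      ∃ B ⊆ E, MeasurableSet B ∧ μ B ≠ 0 ∧ μ (E \ B) ≠ 0) :
    ∃ B : ℕ → Set Ω, (∀ n, MeasurableSet (B n)) ∧ (∀ n, μ (B n) ≠ 0) ∧ (∀ n, B n ⊆ G) ∧
      Pairwise (Function.onFun Disjoint B) := by
  choose! f hfE hfm hf0 hfd using hsplit
  let E : ℕ → Set Ω := fun n => f^[n] G
  have hsucc (n) : E (n + 1) = f (E n) := Function.iterate_succ_apply' f n G
  have hE (n) : E n ⊆ G ∧ MeasurableSet (E n) ∧ μ (E n) ≠ 0 := by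
    induction n with
    | zero => exact ⟨Subset.rfl, hG, hG0⟩
    | succ n ih =>
      obtain ⟨h₁, h₂, h₃⟩ := ih
      rw [hsucc]
      exact ⟨(hfE _ h₁ h₂ h₃).trans h₁, hfm _ h₁ h₂ h₃, hf0 _ h₁ h₂ h₃⟩
  have hanti : Antitone E := antitone_nat_of_succ_le fun n => by
    rw [hsucc]
    exact hfE _ (hE n).1 (hE n).2.1 (hE n).2.2
  refine ⟨fun n => E n \ E (n + 1), fun n => (hE n).2.1.diff (hE (n + 1)).2.1, fun n => ?_,
    fun n => sdiff_subset.trans (hE n).1, ?_⟩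
  · dsimp only
    rw [hsucc]
    exact hfd _ (hE n).1 (hE n).2.1 (hE n).2.2
  · refine (pairwise_disjoint_on _).2 fun m n hmn => ?_
    exact Set.disjoint_left.2 fun s hs hs' => hs.2 (hanti (Nat.succ_le_of_lt hmn) hs'.1)

/-- The points of positive measure of an s-finite measure form a countable set. -/
lemma countable_setOf_measure_singleton_pos [MeasurableSingletonClass Ω] [SFinite μ] :
    {s : Ω | 0 < μ {s}}.Countable :=
  Measure.countable_meas_pos_of_disjoint_iUnion (fun s => measurableSet_singleton s)
    fun _ _ h => Set.disjoint_singleton.2 h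

/-- The multiplier of a compact multiplication operator vanishes almost everywhere off the
points of positive measure. -/
lemma ae_eq_zero_off_atoms [MeasurableSingletonClass Ω] [SigmaFinite μ]
    [TopologicalSpace.SeparableSpace H]
    (hatom : ∀ G : Set Ω, MeasurableSet G → 0 < μ G →
      (∀ B : Set Ω, B ⊆ G → MeasurableSet B → μ B = 0 ∨ μ B = μ G) →
      ∃ x ∈ G, μ {x} = μ G ∧ μ (G \ {x}) = 0)
    {A : Ω → H →L[ℂ] H} (hmeas : ∀ x : H, StronglyMeasurable fun s => A s x)
    {T : Lp H 2 μ →L[ℂ] Lp H 2 μ} (hA : ∀ x : Lp H 2 μ, ⇑(T x) =ᵐ[μ] fun s => A s (x s))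
    (hT : IsCompactOperator ⇑T) : ∀ᵐ s ∂μ, μ {s} = 0 → A s = 0 := by
  have hlevel (x : H) (k : ℕ) : μ {s | μ {s} = 0 ∧ 1 / ((k : ℝ) + 1) ≤ ‖A s x‖} = 0 := by
    by_contra hne
    have hDm : MeasurableSet {s | μ {s} = 0 ∧ 1 / ((k : ℝ) + 1) ≤ ‖A s x‖} := by
      refine MeasurableSet.inter ?_ (measurableSet_le measurable_const (hmeas x).norm.measurable)
      have hc : {s : Ω | μ {s} = 0} = {s | 0 < μ {s}}ᶜ := by
        ext s
        simp
      change MeasurableSet {s : Ω | μ {s} = 0}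
      rw [hc]
      exact countable_setOf_measure_singleton_pos.measurableSet.compl
    obtain ⟨G, hGm, hGD, hG0, hGtop⟩ :=
      Measure.exists_subset_measure_lt_top hDm (pos_iff_ne_zero.2 hne)
    obtain ⟨B, hBm, hB0, hBG, hBd⟩ := exists_seq_disjoint_of_forall_split hGm hG0.ne'
      fun E hEG hE hE0 => by
        by_contra! hno
        obtain ⟨y, hy, hyE, -⟩ := hatom E hE (pos_iff_ne_zero.2 hE0) fun B hBE hB => by
          refine or_iff_not_imp_left.2 fun hB0 => le_antisymm (measure_mono hBE) ?_
          have h := measure_le_inter_add_sdiff μ E B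
          rw [hno B hBE hB hB0, add_zero] at h
          exact h.trans (measure_mono inter_subset_right)
        exact hE0 (hyE ▸ (hGD (hEG hy)).1)
    exact not_isCompactOperator_of_disjoint hA hBm hB0
      (fun n => ((measure_mono (hBG n)).trans_lt hGtop).ne) hBd Nat.one_div_pos_of_nat
      (x := fun _ => x) (fun _ => le_rfl) (fun n s hs => (hGD (hBG n hs)).2) hT
  have hvec (x : H) : ∀ᵐ s ∂μ, μ {s} = 0 → A s x = 0 := by
    have : ∀ᵐ s ∂μ, ∀ k : ℕ, ¬ (μ {s} = 0 ∧ 1 / ((k : ℝ) + 1) ≤ ‖A s x‖) :=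
      ae_all_iff.2 fun k => measure_eq_zero_iff_ae_notMem.1 (hlevel x k)
    filter_upwards [this] with s hs h0
    by_contra hne
    obtain ⟨k, hk⟩ := exists_nat_one_div_lt (norm_pos_iff.2 hne)
    exact hs k ⟨h0, hk.le⟩
  filter_upwards [ae_all_iff.2 fun n => hvec (TopologicalSpace.denseSeq H n)] with s hs h0
  exact DFunLike.coe_injective ((A s).continuous.ext_on (TopologicalSpace.denseRange_denseSeq H)
    continuous_zero (by rintro _ ⟨n, rfl⟩; exact hs n h0))

/-- The values of the multiplier of a compact multiplication operator at points of positive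
measure are compact. -/
lemma isCompactOperator_apply_of_measure_singleton_pos [MeasurableSingletonClass Ω]
    [SigmaFinite μ] {A : Ω → H →L[ℂ] H} {T : Lp H 2 μ →L[ℂ] Lp H 2 μ}
    (hA : ∀ x : Lp H 2 μ, ⇑(T x) =ᵐ[μ] fun s => A s (x s)) (hT : IsCompactOperator ⇑T)
    {s : Ω} (hs : 0 < μ {s}) : IsCompactOperator ⇑(A s) := by
  have htop : μ {s} ≠ ⊤ := measure_singleton_lt_top.ne
  have h := (hT.comp_clm (indicatorConstCLM {s} (measurableSet_singleton s) htop)).clm_comp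
    (evalAtomCLM s hs htop)
  refine (congrArg (IsCompactOperator (M₁ := H) (M₂ := H)) (funext fun x => ?_)).mp h
  simp only [Function.comp_apply, evalAtomCLM_apply, indicatorConstCLM_apply]
  have hx : indicatorConstLp 2 (measurableSet_singleton s) htop x s = x :=
    Measure.holds_of_ae_of_measure_singleton_pos
      (p := fun t => t ∈ ({s} : Set Ω) → indicatorConstLp 2 (measurableSet_singleton s) htop x t = x)
      indicatorConstLp_coeFn_mem hs rfl
  rw [Measure.holds_of_ae_of_measure_singleton_pos (hA _) hs]
  exact congrArg (A s) hx

/-- The norms of the multiplier of a compact multiplication operator tend to zero along the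
points of positive measure. -/
lemma finite_setOf_le_norm_of_isCompactOperator [MeasurableSingletonClass Ω]
    [SigmaFinite μ] {A : Ω → H →L[ℂ] H} {T : Lp H 2 μ →L[ℂ] Lp H 2 μ}
    (hA : ∀ x : Lp H 2 μ, ⇑(T x) =ᵐ[μ] fun s => A s (x s)) (hT : IsCompactOperator ⇑T)
    {ε : ℝ} (hε : 0 < ε) : {s | 0 < μ {s} ∧ ε ≤ ‖A s‖}.Finite := by
  by_contra hinf
  let e := Set.Infinite.natEmbedding _ hinf
  have hx (n : ℕ) : ∃ x : H, ‖x‖ ≤ 1 ∧ ε / 2 ≤ ‖A (e n) x‖ := by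
    obtain ⟨x, hx, hlt⟩ := (A (e n)).exists_lt_apply_of_lt_opNorm
      (r := ε / 2) (by linarith [(e n).2.2])
    exact ⟨x, hx.le, hlt.le⟩
  choose x hx1 hxA using hx
  refine not_isCompactOperator_of_disjoint hA (B := fun n => {(e n : Ω)})
    (fun n => measurableSet_singleton _) (fun n => (e n).2.1.ne')
    (fun n => measure_singleton_lt_top.ne) (fun m n hmn => ?_) (half_pos hε) hx1 ?_ hT
  · exact Set.disjoint_singleton.2 fun h => hmn (e.injective (Subtype.ext h))
  · rintro n _ rfl
    exact hxA n

/-- A multiplication operator concentrated on countably many points of positive measure, with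
compact values whose norms tend to zero, is compact. -/
lemma isCompactOperator_of_atoms [MeasurableSingletonClass Ω] [SigmaFinite μ] [CompleteSpace H]
    {A : Ω → H →L[ℂ] H} {T : Lp H 2 μ →L[ℂ] Lp H 2 μ}
    (hA : ∀ x : Lp H 2 μ, ⇑(T x) =ᵐ[μ] fun s => A s (x s)) {S : Set Ω}
    (hS : ∀ s ∈ S, 0 < μ {s} ∧ IsCompactOperator ⇑(A s))
    (hfin : ∀ ε : ℝ, 0 < ε → {s ∈ S | ε ≤ ‖A s‖}.Finite)
    (hzero : ∀ᵐ s ∂μ, s ∉ S → A s = 0) : IsCompactOperator ⇑T := by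
  have htop (s : Ω) : μ {s} ≠ ⊤ := measure_singleton_lt_top.ne
  let P : S → (Lp H 2 μ →L[ℂ] Lp H 2 μ) := fun s =>
    (indicatorConstCLM {(s : Ω)} (measurableSet_singleton _) (htop s)).comp
      ((A s).comp (evalAtomCLM (s : Ω) (hS s s.2).1 (htop s)))
  have hP (s : S) : IsCompactOperator ⇑(P s) :=
    ((hS s s.2).2.comp_clm (evalAtomCLM (s : Ω) (hS s s.2).1 (htop s))).clm_comp
      (indicatorConstCLM {(s : Ω)} (measurableSet_singleton _) (htop s))
  refine isClosed_setOfPred_isCompactOperator.closure_subset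
    (Metric.mem_closure_iff.2 fun ε hε => ?_)
  have hF : {s : S | ε / 2 ≤ ‖A s‖}.Finite :=
    Set.Finite.of_finite_image ((hfin (ε / 2) (half_pos hε)).subset
      (by rintro _ ⟨s, hs, rfl⟩; exact ⟨s.2, hs⟩)) Subtype.val_injective.injOn
  refine ⟨∑ s ∈ hF.toFinset, P s,
    (compactOperator (RingHom.id ℂ) (Lp H 2 μ) (Lp H 2 μ)).sum_mem fun s _ => hP s, ?_⟩
  rw [dist_eq_norm]
  refine lt_of_le_of_lt (ContinuousLinearMap.opNorm_le_bound _ (half_pos hε).le fun f => ?_)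
    (half_lt_self hε)
  refine Lp.norm_le_mul_norm_of_ae_le_mul ?_
  have hcoe : ∀ᵐ t ∂μ, ∀ s ∈ hF.toFinset,
      P s f t = ({(s : Ω)} : Set Ω).indicator (fun _ => A s (f s)) t :=
    (Finset.eventually_all _).2 fun s _ =>
      indicatorConstLp_coeFn (hs := measurableSet_singleton (s : Ω)) (hμs := htop s)
  have hsum : ⇑((∑ s ∈ hF.toFinset, P s) f) =ᵐ[μ] fun t => ∑ s ∈ hF.toFinset, P s f t := by
    rw [sum_apply]
    exact Lp.coeFn_fun_finsetSum hF.toFinset fun s => P s f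
  filter_upwards [hcoe, hsum, hA f, hzero,
    Lp.coeFn_sub (T f) ((∑ s ∈ hF.toFinset, P s) f)] with t h₁ h₂ h₃ h₄ h₅
  rw [sub_apply, h₅, Pi.sub_apply, h₂, h₃, Finset.sum_congr rfl h₁]
  by_cases ht : ∃ htS : t ∈ S, ε / 2 ≤ ‖A t‖
  · obtain ⟨htS, hle⟩ := ht
    rw [Finset.sum_eq_single (⟨t, htS⟩ : S)]
    · simp only [mem_singleton_iff, indicator_of_mem, sub_self, norm_zero]
      positivity
    · intro s _ hs
      exact indicator_of_notMem (fun h => hs (Subtype.ext (mem_singleton_iff.1 h).symm)) _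
    · intro h
      exact absurd (hF.mem_toFinset.2 hle) h
  · rw [Finset.sum_eq_zero, sub_zero]
    · have hAt : ‖A t‖ ≤ ε / 2 := by
        by_cases htS : t ∈ S
        · by_contra! hlt
          exact ht ⟨htS, hlt.le⟩
        · rw [h₄ htS, norm_zero]
          positivity
      exact (A t).le_of_opNorm_le hAt _
    · intro s hs
      refine indicator_of_notMem (fun h => ht ?_) _
      rw [mem_singleton_iff.1 h]
      exact ⟨s.2, hF.mem_toFinset.1 hs⟩

end

variable {Ω : Type*} [MeasurableSpace Ω] {μ : Measure Ω} [SigmaFinite μ]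
variable {H : Type*} [NormedAddCommGroup H] [InnerProductSpace ℂ H] [CompleteSpace H]
  [TopologicalSpace.SeparableSpace H]

/-- Assume all singletons measurable and every atom of `μ` is a point of
positive measure up to a null set. Then `M_A` is compact iff there is a countable set `S` of
points of positive `μ`-measure on which `A` is a nonzero compact operator, with
`‖A s‖, s ∈ S` tending to zero (each level set `{s ∈ S | ε ≤ ‖A s‖}` finite), and `A s = 0`
for a.e. `s ∉ S`. -/
theorem multiplication_compact_iff
    (hsing : ∀ s : Ω, MeasurableSet ({s} : Set Ω))
    (hatom : ∀ G : Set Ω, MeasurableSet G → 0 < μ G →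
      (∀ B : Set Ω, B ⊆ G → MeasurableSet B → μ B = 0 ∨ μ B = μ G) →
      ∃ x ∈ G, μ {x} = μ G ∧ μ (G \ {x}) = 0)
    (A : Ω → H →L[ℂ] H)
    (hmeas : ∀ x : H, StronglyMeasurable fun s => A s x)
    (C : ℝ) (hbdd : ∀ᵐ s ∂μ, ‖A s‖ ≤ C)
    (MA : Lp H 2 μ →L[ℂ] Lp H 2 μ)
    (hMA : ∀ x : Lp H 2 μ, ⇑(MA x) =ᵐ[μ] fun s => A s (x s)) :
    IsCompactOperator ⇑MA ↔
      ∃ S : Set Ω, S.Countable ∧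
        (∀ s ∈ S, 0 < μ {s} ∧ IsCompactOperator ⇑(A s) ∧ A s ≠ 0) ∧
        (∀ ε : ℝ, 0 < ε → {s ∈ S | ε ≤ ‖A s‖}.Finite) ∧
        (∀ᵐ s ∂μ, s ∉ S → A s = 0) := by
  have : MeasurableSingletonClass Ω := ⟨hsing⟩
  refine ⟨fun hT => ⟨{s | 0 < μ {s} ∧ A s ≠ 0}, ?_, ?_, ?_, ?_⟩, ?_⟩
  · exact countable_setOf_measure_singleton_pos.mono fun s hs => hs.1
  · exact fun s hs =>
      ⟨hs.1, isCompactOperator_apply_of_measure_singleton_pos hMA hT hs.1, hs.2⟩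
  · exact fun ε hε => (finite_setOf_le_norm_of_isCompactOperator hMA hT hε).subset
      fun s hs => ⟨hs.1.1, hs.2⟩
  · filter_upwards [ae_eq_zero_off_atoms hatom hmeas hMA hT] with s hs hsS
    by_contra hne
    exact hsS ⟨pos_iff_ne_zero.2 fun h => hne (hs h), hne⟩
  · rintro ⟨S, -, hS, hfin, hzero⟩
    exact isCompactOperator_of_atoms hMA (fun s hs => ⟨(hS s hs).1, (hS s hs).2.1⟩) hfin hzero
end
end

section
/- The family (𝒯(t))_{t≥0} is a C₀-semigroup on L²(Ω, μ; H) if and only if there exist M ≥ 1 and ω ∈ ℝ such that for a.e. s ∈ Ω, ‖T(s,t)‖ ≤ M e^{ωt} for all t > 0. In that case, ‖𝒯(t)‖ ≤ M e^{ωt} for all t ≥ 0. -/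
open MeasureTheory Filter Topology Set

noncomputable section

/-- A `C₀`-semigroup on a Banach space is exponentially bounded. -/
theorem IsC0Semigroup.exists_norm_le {K : Type*} [NormedAddCommGroup K] [NormedSpace ℂ K]
    [CompleteSpace K] {T : ℝ → K →L[ℂ] K} (hT : IsC0Semigroup T) :
    ∃ M : ℝ, 1 ≤ M ∧ ∃ ω : ℝ, ∀ t : ℝ, 0 ≤ t → ‖T t‖ ≤ M * Real.exp (ω * t) := by
  obtain ⟨-, hadd, hcont⟩ := hT
  obtain ⟨C, hC⟩ : ∃ C, ∀ t : Icc (0 : ℝ) 1, ‖T t‖ ≤ C := by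
    refine banach_steinhaus fun x => ?_
    obtain ⟨C, hC⟩ := isCompact_Icc.exists_bound_of_continuousOn
      ((hcont x).mono (Icc_subset_Ici_self : Icc (0 : ℝ) 1 ⊆ Ici 0))
    exact ⟨C, fun t => hC t t.2⟩
  set M := max 1 C
  have hM1 : 1 ≤ M := le_max_left _ _
  have hM0 : 0 < M := by linarith
  have hpow : ∀ n : ℕ, ∀ t : ℝ, 0 ≤ t → t ≤ n + 1 → ‖T t‖ ≤ M ^ (n + 1) := by
    intro n
    induction n with
    | zero =>
      intro t h0 h1
      rw [zero_add, pow_one]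
      exact (hC ⟨t, h0, by simpa using h1⟩).trans (le_max_right 1 C)
    | succ n ih =>
      intro t h0 h1
      push_cast at h1
      rcases le_total t (n + 1) with h | h
      · exact (ih t h0 h).trans (pow_le_pow_right₀ hM1 (Nat.le_succ _))
      · have hn : (0 : ℝ) ≤ n := n.cast_nonneg
        have heq : T t = (T 1).comp (T (t - 1)) := by
          rw [← hadd 1 (t - 1) zero_le_one (by linarith)]
          congr 1
          ring
        have hT1 : ‖T 1‖ ≤ M :=
          (hC ⟨1, zero_le_one, le_rfl⟩).trans (le_max_right 1 C)
        calc ‖T t‖ ≤ ‖T 1‖ * ‖T (t - 1)‖ := heq ▸ ContinuousLinearMap.opNorm_comp_le _ _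
          _ ≤ M * M ^ (n + 1) := by
            gcongr
            exact ih _ (by linarith) (by linarith)
          _ = M ^ (n + 1 + 1) := by ring
  refine ⟨M, hM1, Real.log M, fun t ht => ?_⟩
  calc ‖T t‖ ≤ M ^ (⌊t⌋₊ + 1) := hpow _ t ht (Nat.lt_floor_add_one t).le
    _ = M * M ^ (⌊t⌋₊ : ℝ) := by rw [Real.rpow_natCast]; ring
    _ ≤ M * M ^ t := by
      gcongr
      exact Nat.floor_le ht
    _ = M * Real.exp (Real.log M * t) := by rw [Real.rpow_def_of_pos hM0]

/-- For a `C₀`-semigroup, an exponential bound at positive rational times holds at all positive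
times. -/
theorem IsC0Semigroup.norm_le_of_forall_rat {K : Type*} [NormedAddCommGroup K] [NormedSpace ℂ K]
    {T : ℝ → K →L[ℂ] K} (hT : IsC0Semigroup T) {M ω : ℝ} (hM : 0 ≤ M)
    (h : ∀ q : ℚ, 0 < q → ‖T q‖ ≤ M * Real.exp (ω * q)) {t : ℝ} (ht : 0 < t) :
    ‖T t‖ ≤ M * Real.exp (ω * t) := by
  refine ContinuousLinearMap.opNorm_le_bound _ (by positivity) fun x => ?_
  obtain ⟨u, -, hu, hlim⟩ := Real.exists_seq_rat_strictAnti_tendsto t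
  have hpos : ∀ n, 0 < u n := fun n => by exact_mod_cast ht.trans (hu n)
  have hTu : Tendsto (fun n => T (u n) x) atTop (𝓝 (T t x)) :=
    (hT.2.2 x t ht.le).tendsto.comp (tendsto_nhdsWithin_iff.2
      ⟨hlim, Eventually.of_forall fun n => (ht.trans (hu n)).le⟩)
  have hexp : Tendsto (fun n => M * Real.exp (ω * u n) * ‖x‖) atTop
      (𝓝 (M * Real.exp (ω * t) * ‖x‖)) :=
    (((Real.continuous_exp.tendsto _).comp (hlim.const_mul ω)).const_mul M).mul_const _
  exact le_of_tendsto_of_tendsto' hTu.norm hexp fun n =>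
    (T (u n)).le_of_opNorm_le (h _ (hpos n)) x

/-- Dominated convergence in `L²` along a countably generated filter. -/
theorem tendsto_Lp_two_of_dominated {α E ι : Type*} [MeasurableSpace α] {ν : Measure α}
    [NormedAddCommGroup E] {l : Filter ι} [l.IsCountablyGenerated]
    {F : ι → Lp E 2 ν} {G : ι → α → E} {f g : Lp E 2 ν} {C : ℝ}
    (hFG : ∀ᶠ i in l, F i =ᵐ[ν] G i)
    (hbound : ∀ᶠ i in l, ∀ᵐ s ∂ν, ‖G i s - f s‖ ≤ C * ‖g s‖)
    (hlim : ∀ᵐ s ∂ν, Tendsto (fun i => G i s) l (𝓝 (f s))) :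
    Tendsto F l (𝓝 f) := by
  have hint : Tendsto (fun i => ∫ s, ‖G i s - f s‖ ^ 2 ∂ν) l (𝓝 (∫ _, (0 : ℝ) ∂ν)) := by
    refine tendsto_integral_filter_of_dominated_convergence (fun s => (C * ‖g s‖) ^ 2)
      ?_ ?_ ?_ ?_
    · filter_upwards [hFG] with i hi
      exact (((Lp.aestronglyMeasurable (F i)).congr hi).sub
        (Lp.aestronglyMeasurable f)).norm.pow 2
    · filter_upwards [hbound] with i hi
      filter_upwards [hi] with s hs
      rw [Real.norm_of_nonneg (by positivity)]
      gcongr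
    · exact ((Lp.memLp g).norm.const_mul C).integrable_sq
    · filter_upwards [hlim] with s hs
      simpa using ((hs.sub_const (f s)).norm.pow 2)
  rw [integral_zero] at hint
  have hnorm : ∀ᶠ i in l, (∫ s, ‖G i s - f s‖ ^ 2 ∂ν) ^ (2⁻¹ : ℝ) = ‖F i - f‖ := by
    filter_upwards [hFG] with i hi
    rw [Lp.norm_def, (Lp.memLp (F i - f)).eLpNorm_eq_integral_rpow_norm two_ne_zero
      ENNReal.ofNat_ne_top, ENNReal.toReal_ofReal (by positivity)]
    simp only [ENNReal.toReal_ofNat, Real.rpow_two]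
    congr 1
    refine integral_congr_ae ?_
    filter_upwards [hi, Lp.coeFn_sub (F i) f] with s h1 h2
    rw [h2, Pi.sub_apply, h1]
  rw [tendsto_iff_norm_sub_tendsto_zero]
  refine Tendsto.congr' hnorm ?_
  simpa using hint.rpow_const (p := 2⁻¹) (Or.inr (by norm_num))

/-- If multiplication by the strongly measurable operator-valued function `A` is bounded by `C` on
`L²`, then `‖A s‖ ≤ C` for almost every `s`. -/
theorem ae_norm_le_of_multiplication_norm_le {α E : Type*} [MeasurableSpace α] {ν : Measure α}
    [SigmaFinite ν] [NormedAddCommGroup E] [NormedSpace ℂ E] [TopologicalSpace.SeparableSpace E]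
    {A : α → E →L[ℂ] E} (hA : ∀ x, StronglyMeasurable fun s => A s x)
    {𝒜 : Lp E 2 ν →L[ℂ] Lp E 2 ν} (h𝒜 : ∀ x : Lp E 2 ν, 𝒜 x =ᵐ[ν] fun s => A s (x s))
    {C : ℝ} (hC : ‖𝒜‖ ≤ C) : ∀ᵐ s ∂ν, ‖A s‖ ≤ C := by
  have hC0 : 0 ≤ C := (norm_nonneg _).trans hC
  have key : ∀ y : E, ∀ᵐ s ∂ν, ‖A s y‖ ≤ C * ‖y‖ := by
    intro y
    have hle : (fun s => ‖A s y‖ₑ ^ (2 : ℝ)) ≤ᵐ[ν] fun _ => (ENNReal.ofReal C * ‖y‖ₑ) ^ (2 : ℝ) := by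
      refine ae_le_of_forall_setLIntegral_le_of_sigmaFinite
        ((hA y).enorm.pow_const _) fun S hS hνS => ?_
      have hsq : ∀ f : α → E, eLpNorm f 2 ν ^ (2 : ℝ) = ∫⁻ s, ‖f s‖ₑ ^ (2 : ℝ) ∂ν := fun f => by
        simpa using eLpNorm_nnreal_pow_eq_lintegral (f := f) (μ := ν) (p := 2) two_ne_zero
      set x : Lp E 2 ν := indicatorConstLp 2 hS hνS.ne y
      have hx' : x =ᵐ[ν] S.indicator fun _ => y := indicatorConstLp_coeFn
      have h1 : ∫⁻ s in S, ‖A s y‖ₑ ^ (2 : ℝ) ∂ν = ‖𝒜 x‖ₑ ^ (2 : ℝ) := by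
        rw [Lp.enorm_def, hsq, ← lintegral_indicator hS]
        refine lintegral_congr_ae ?_
        filter_upwards [h𝒜 x, hx'] with s h1 h2
        rw [h1, h2]
        by_cases hs : s ∈ S <;> simp [hs]
      have h2 : ∫⁻ _ in S, (ENNReal.ofReal C * ‖y‖ₑ) ^ (2 : ℝ) ∂ν
          = (ENNReal.ofReal C * ‖x‖ₑ) ^ (2 : ℝ) := by
        rw [ENNReal.mul_rpow_of_nonneg _ _ zero_le_two, ENNReal.mul_rpow_of_nonneg _ _ zero_le_two,
          Lp.enorm_def, hsq, lintegral_congr_ae (hx'.mono fun s hs => by rw [hs])]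
        have : (fun s => ‖S.indicator (fun _ => y) s‖ₑ ^ (2 : ℝ))
            = S.indicator fun _ => ‖y‖ₑ ^ (2 : ℝ) := by
          ext s
          by_cases hs : s ∈ S <;> simp [hs]
        rw [this, lintegral_indicator hS, setLIntegral_const, setLIntegral_const, mul_assoc]
      rw [h1, h2]
      gcongr
      rw [← ofReal_norm, ← ofReal_norm, ← ENNReal.ofReal_mul hC0]
      exact ENNReal.ofReal_le_ofReal (𝒜.le_of_opNorm_le hC x)
    filter_upwards [hle] with s hs
    have := (ENNReal.rpow_le_rpow_iff zero_lt_two).1 hs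
    rwa [← ofReal_norm, ← ofReal_norm, ← ENNReal.ofReal_mul hC0,
      ENNReal.ofReal_le_ofReal_iff (by positivity)] at this
  filter_upwards [ae_all_iff.2 fun n => key (TopologicalSpace.denseSeq E n)] with s hs
  refine ContinuousLinearMap.opNorm_le_bound _ hC0 fun y => ?_
  exact (TopologicalSpace.denseRange_denseSeq E).induction_on
    (p := fun y => ‖A s y‖ ≤ C * ‖y‖) y
    (isClosed_le (A s).continuous.norm (continuous_const.mul continuous_norm)) hs

variable {Ω : Type*} [MeasurableSpace Ω] {μ : Measure Ω} [SigmaFinite μ]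
variable {H : Type*} [NormedAddCommGroup H] [InnerProductSpace ℂ H] [CompleteSpace H]
  [TopologicalSpace.SeparableSpace H]

/-- The direct integral family `𝒯 t = M_{T(·,t)}` is a `C₀`-semigroup on
`L²(Ω, μ; H)` iff there are `M ≥ 1`, `ω ∈ ℝ` with `‖T s t‖ ≤ M e^{ω t}` for a.e. `s` and all
`t > 0`; in that case `‖𝒯 t‖ ≤ M e^{ω t}` for all `t ≥ 0`. -/
theorem directIntegral_semigroup_iff (T : Ω → ℝ → H →L[ℂ] H)
    (hsg : ∀ᵐ s ∂μ, IsC0Semigroup (T s))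
    (hmeas : ∀ t : ℝ, 0 ≤ t → ∀ x : H, StronglyMeasurable fun s => T s t x)
    (hbdd : ∀ t : ℝ, 0 ≤ t → ∃ C : ℝ, ∀ᵐ s ∂μ, ‖T s t‖ ≤ C)
    (𝒯 : ℝ → Lp H 2 μ →L[ℂ] Lp H 2 μ)
    (h𝒯 : ∀ t : ℝ, 0 ≤ t → ∀ x : Lp H 2 μ, ⇑(𝒯 t x) =ᵐ[μ] fun s => T s t (x s)) :
    (IsC0Semigroup 𝒯 ↔ ∃ M : ℝ, 1 ≤ M ∧ ∃ ω : ℝ,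
        ∀ᵐ s ∂μ, ∀ t : ℝ, 0 < t → ‖T s t‖ ≤ M * Real.exp (ω * t)) ∧
    ∀ M ω : ℝ, 1 ≤ M →
      (∀ᵐ s ∂μ, ∀ t : ℝ, 0 < t → ‖T s t‖ ≤ M * Real.exp (ω * t)) →
      ∀ t : ℝ, 0 ≤ t → ‖𝒯 t‖ ≤ M * Real.exp (ω * t) := by
  have hnorm : ∀ M ω : ℝ, 1 ≤ M →
      (∀ᵐ s ∂μ, ∀ t : ℝ, 0 < t → ‖T s t‖ ≤ M * Real.exp (ω * t)) →
      ∀ᵐ s ∂μ, ∀ t : ℝ, 0 ≤ t → ‖T s t‖ ≤ M * Real.exp (ω * t) := by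
    intro M ω hM h
    filter_upwards [h, hsg] with s hs hs' t ht
    rcases ht.eq_or_lt with rfl | ht
    · rw [hs'.1]
      rw [mul_zero, Real.exp_zero, mul_one]
      exact ContinuousLinearMap.norm_id_le.trans hM
    · exact hs t ht
  refine ⟨⟨fun h => ?_, ?_⟩, fun M ω hM h t ht => ?_⟩
  · obtain ⟨M, hM, ω, hMω⟩ := h.exists_norm_le
    refine ⟨M, hM, ω, ?_⟩
    have hrat : ∀ᵐ s ∂μ, ∀ q : ℚ, 0 < q → ‖T s q‖ ≤ M * Real.exp (ω * q) := by
      refine ae_all_iff.2 fun q => ?_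
      by_cases hq : 0 < q
      · have hq' : (0 : ℝ) ≤ q := by exact_mod_cast hq.le
        filter_upwards [ae_norm_le_of_multiplication_norm_le (hmeas q hq') (h𝒯 q hq')
          (hMω q hq')] with s hs _ using hs
      · exact Eventually.of_forall fun s h => absurd h hq
    filter_upwards [hsg, hrat] with s h1 h2 t ht
    exact h1.norm_le_of_forall_rat (by linarith) h2 ht
  · rintro ⟨M, hM, ω, h⟩
    replace h := hnorm M ω hM h
    refine ⟨?_, fun t u ht hu => ?_, fun x t₀ ht₀ => ?_⟩
    · ext1 x
      refine Lp.ext ?_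
      filter_upwards [h𝒯 0 le_rfl x, hsg] with s h1 h2
      rw [h1, h2.1]
      rfl
    · ext1 x
      refine Lp.ext ?_
      filter_upwards [h𝒯 (t + u) (add_nonneg ht hu) x, h𝒯 u hu x, h𝒯 t ht (𝒯 u x), hsg]
        with s h1 h2 h3 h4
      rw [h1, h4.2.1 t u ht hu, ContinuousLinearMap.comp_apply, ContinuousLinearMap.comp_apply,
        h3, h2]
    · refine tendsto_Lp_two_of_dominated (G := fun t s => T s t (x s)) (g := x)
        (C := 2 * (M * Real.exp (|ω| * (t₀ + 1)))) ?_ ?_ ?_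
      · filter_upwards [self_mem_nhdsWithin] with t ht using h𝒯 t ht x
      · have hnear : ∀ᶠ t in 𝓝[Ici 0] t₀, t ≤ t₀ + 1 :=
          mem_nhdsWithin_of_mem_nhds (Iic_mem_nhds (by linarith))
        filter_upwards [self_mem_nhdsWithin, hnear] with t ht ht1
        filter_upwards [h𝒯 t₀ ht₀ x, h] with s h1 h2
        have hle : ∀ r : ℝ, 0 ≤ r → r ≤ t₀ + 1 →
            ‖T s r (x s)‖ ≤ M * Real.exp (|ω| * (t₀ + 1)) * ‖x s‖ := by
          intro r hr hr1
          refine (T s r).le_of_opNorm_le ((h2 r hr).trans ?_) (x s)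
          have : ω * r ≤ |ω| * (t₀ + 1) :=
            (mul_le_mul_of_nonneg_right (le_abs_self ω) hr).trans
              (mul_le_mul_of_nonneg_left hr1 (abs_nonneg ω))
          gcongr
        rw [h1]
        have h3 := hle t ht ht1
        have h4 := hle t₀ ht₀ (by linarith)
        linarith [norm_sub_le (T s t (x s)) (T s t₀ (x s))]
      · filter_upwards [h𝒯 t₀ ht₀ x, hsg] with s h1 h2
        rw [h1]
        exact (h2.2.2 (x s) t₀ ht₀).tendsto
  · refine ContinuousLinearMap.opNorm_le_bound _ (by positivity) fun x => ?_
    refine Lp.norm_le_mul_norm_of_ae_le_mul ?_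
    filter_upwards [h𝒯 t ht x, hnorm M ω hM h] with s h1 h2
    rw [h1]
    exact (T s t).le_of_opNorm_le (h2 t ht) (x s)
end
end

section
/- Assume there exist M ≥ 1 and ω ∈ ℝ such that for a.e. s ∈ Ω, ‖T(s,t)‖ ≤ M e^{ωt} for all t ≥ 0, so that (𝒯(t))_{t≥0} is a C₀-semigroup on L²(Ω, μ; H). For a.e. s ∈ Ω let A(s) denote the generator of (T(s,t))_{t≥0}, and let 𝒜 denote the generator of (𝒯(t))_{t≥0}. Then D(𝒜) = {x ∈ L²(Ω, μ; H) : x(s) ∈ D(A(s)) for a.e. s ∈ Ω and s ↦ A(s)x(s) belongs to L²(Ω, μ; H)}, and for every x ∈ D(𝒜), (𝒜x)(s) = A(s)x(s) for a.e. s ∈ Ω. -/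
open MeasureTheory Filter Topology Set

noncomputable section

namespace IsC0Semigroup

variable {K : Type*} [NormedAddCommGroup K] [NormedSpace ℂ K] {T : ℝ → K →L[ℂ] K}

lemma intervalIntegrable (hT : IsC0Semigroup T) (x : K) {a b : ℝ} (ha : 0 ≤ a) (hb : 0 ≤ b) :
    IntervalIntegrable (fun r => T r x) volume a b :=
  ((hT.2.2 x).mono fun _ hr => (le_min ha hb).trans hr.1).intervalIntegrable

/-- Averages of an orbit over `[0, h]` converge to its starting point. -/
lemma tendsto_average [CompleteSpace K] (hT : IsC0Semigroup T) (x : K) :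
    Tendsto (fun h : ℝ => h⁻¹ • ∫ r in (0:ℝ)..h, T r x) (𝓝[>] 0) (𝓝 x) := by
  have h0 : Tendsto (fun r => T r x) (𝓝[Ici 0] 0) (𝓝 x) := by
    have := hT.2.2 x 0 self_mem_Ici
    simpa [ContinuousWithinAt, hT.1] using this
  rw [Metric.tendsto_nhds]
  intro ε hε
  rw [Metric.tendsto_nhds] at h0
  obtain ⟨δ, hδ, hball⟩ := Metric.mem_nhdsWithin_iff.1 (h0 (ε / 2) (half_pos hε))
  filter_upwards [Ioo_mem_nhdsGT hδ] with h hh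
  have hle : ‖∫ r in (0:ℝ)..h, (T r x - x)‖ ≤ ε / 2 * |h - 0| := by
    refine intervalIntegral.norm_integral_le_of_norm_le_const fun r hr => ?_
    rw [uIoc_of_le hh.1.le] at hr
    have hr' : r ∈ Metric.ball (0:ℝ) δ ∩ Ici 0 := by
      refine ⟨?_, hr.1.le⟩
      rw [Metric.mem_ball, Real.dist_0_eq_abs, abs_of_pos hr.1]
      exact hr.2.trans_lt hh.2
    have hr'' : dist (T r x) x < ε / 2 := hball hr'
    exact (dist_eq_norm (T r x) x) ▸ hr''.le
  rw [intervalIntegral.integral_sub (hT.intervalIntegrable x le_rfl hh.1.le)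
    intervalIntegrable_const, intervalIntegral.integral_const, sub_zero, abs_of_pos hh.1] at hle
  have heq : h⁻¹ • (∫ r in (0:ℝ)..h, T r x) - x =
      h⁻¹ • ((∫ r in (0:ℝ)..h, T r x) - h • x) := by
    rw [smul_sub, inv_smul_smul₀ hh.1.ne']
  rw [dist_eq_norm, heq, norm_smul, norm_inv, Real.norm_of_nonneg hh.1.le,
    inv_mul_lt_iff₀ hh.1]
  nlinarith [hh.1]

lemma integral_apply_sub [CompleteSpace K] (hT : IsC0Semigroup T) (x : K) {t h : ℝ}
    (ht : 0 ≤ t) (hh : 0 ≤ h) :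
    ∫ r in (0:ℝ)..t, T r (T h x - x) =
      T t (∫ r in (0:ℝ)..h, T r x) - ∫ r in (0:ℝ)..h, T r x := by
  have e1 : ∫ r in (0:ℝ)..t, T r (T h x) = ∫ r in h..(t + h), T r x := by
    have := intervalIntegral.integral_comp_add_right (a := 0) (b := t) (fun r => T r x) h
    rw [zero_add] at this
    rw [← this]
    refine intervalIntegral.integral_congr fun r hr => ?_
    rw [uIcc_of_le ht] at hr
    simp [hT.2.1 r h hr.1 hh]
  have e2 : T t (∫ r in (0:ℝ)..h, T r x) = ∫ r in t..(t + h), T r x := by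
    have := intervalIntegral.integral_comp_add_left (a := 0) (b := h) (fun r => T r x) t
    rw [add_zero] at this
    rw [← this, ← ContinuousLinearMap.intervalIntegral_comp_comm _
      (hT.intervalIntegrable x le_rfl hh)]
    refine intervalIntegral.integral_congr fun r hr => ?_
    rw [uIcc_of_le hh] at hr
    simp [hT.2.1 t r ht hr.1]
  have hth : 0 ≤ t + h := add_nonneg ht hh
  have a1 := intervalIntegral.integral_add_adjacent_intervals
    (hT.intervalIntegrable x le_rfl hh) (hT.intervalIntegrable x hh hth)
  have a2 := intervalIntegral.integral_add_adjacent_intervals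
    (hT.intervalIntegrable x le_rfl ht) (hT.intervalIntegrable x ht hth)
  simp only [map_sub]
  rw [intervalIntegral.integral_sub (hT.intervalIntegrable _ le_rfl ht)
    (hT.intervalIntegrable x le_rfl ht), e1, e2, sub_eq_sub_iff_add_eq_add,
    add_comm _ (∫ r in (0:ℝ)..h, T r x), a1, add_comm _ (∫ r in (0:ℝ)..t, T r x), a2]

/-- If the difference quotients of the orbit of `x` converge to `y` along some times tending to
`0⁺`, then the orbit is the integral of the orbit of `y`. -/
lemma apply_sub_eq_integral [CompleteSpace K] (hT : IsC0Semigroup T) {ι : Type*} {l : Filter ι}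
    [l.NeBot] {h : ι → ℝ} (hh : Tendsto h l (𝓝[>] 0)) {x y : K}
    (hxy : Tendsto (fun i => (h i)⁻¹ • (T (h i) x - x)) l (𝓝 y)) {t C : ℝ} (ht : 0 ≤ t)
    (hC : ∀ r ∈ Icc 0 t, ‖T r‖ ≤ C) :
    T t x - x = ∫ r in (0:ℝ)..t, T r y := by
  have h1 : Tendsto (fun i => ∫ r in (0:ℝ)..t, T r ((h i)⁻¹ • (T (h i) x - x))) l
      (𝓝 (∫ r in (0:ℝ)..t, T r y)) := by
    rw [tendsto_iff_norm_sub_tendsto_zero] at hxy ⊢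
    have hlim := (hxy.const_mul C).mul_const |t - 0|
    rw [mul_zero, zero_mul] at hlim
    refine squeeze_zero (fun _ => norm_nonneg _) (fun i => ?_) hlim
    rw [← intervalIntegral.integral_sub
      (hT.intervalIntegrable ((h i)⁻¹ • (T (h i) x - x)) le_rfl ht)
      (hT.intervalIntegrable y le_rfl ht)]
    refine intervalIntegral.norm_integral_le_of_norm_le_const fun r hr => ?_
    rw [uIoc_of_le ht] at hr
    rw [← map_sub]
    exact (T r).le_of_opNorm_le (hC r ⟨hr.1.le, hr.2⟩) _
  have h2 : Tendsto (fun i => T t ((h i)⁻¹ • ∫ r in (0:ℝ)..h i, T r x) -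
      (h i)⁻¹ • ∫ r in (0:ℝ)..h i, T r x) l (𝓝 (T t x - x)) := by
    have := (hT.tendsto_average x).comp hh
    exact (((T t).continuous.tendsto x).comp this).sub this
  refine tendsto_nhds_unique (h2.congr' ?_) h1
  filter_upwards [hh.eventually self_mem_nhdsWithin] with i hi
  have hlin (r : ℝ) (z : K) : T r ((h i)⁻¹ • z) = (h i)⁻¹ • T r z :=
    (T r).map_smul_of_tower _ _
  simp only [hlin]
  rw [intervalIntegral.integral_smul, hT.integral_apply_sub x ht (mem_Ioi.1 hi).le, smul_sub]

lemma norm_differenceQuotient_le [CompleteSpace K] (hT : IsC0Semigroup T) {x y : K}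
    (hxy : Tendsto (fun h : ℝ => h⁻¹ • (T h x - x)) (𝓝[>] 0) (𝓝 y)) {t C : ℝ} (ht : 0 < t)
    (hC : ∀ r ∈ Icc 0 t, ‖T r‖ ≤ C) :
    ‖t⁻¹ • (T t x - x)‖ ≤ C * ‖y‖ := by
  rw [hT.apply_sub_eq_integral tendsto_id hxy ht.le hC, norm_smul, norm_inv,
    Real.norm_of_nonneg ht.le, inv_mul_le_iff₀ ht]
  have : ‖∫ r in (0:ℝ)..t, T r y‖ ≤ C * ‖y‖ * |t - 0| := by
    refine intervalIntegral.norm_integral_le_of_norm_le_const fun r hr => ?_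
    rw [uIoc_of_le ht.le] at hr
    exact (T r).le_of_opNorm_le (hC r ⟨hr.1.le, hr.2⟩) _
  rwa [sub_zero, abs_of_pos ht, mul_comm] at this

/-- Convergence of the difference quotients along some times tending to `0⁺` implies
convergence as `t → 0⁺`. -/
lemma tendsto_differenceQuotient [CompleteSpace K] (hT : IsC0Semigroup T) {ι : Type*}
    {l : Filter ι} [l.NeBot] {h : ι → ℝ} (hh : Tendsto h l (𝓝[>] 0)) {x y : K}
    (hxy : Tendsto (fun i => (h i)⁻¹ • (T (h i) x - x)) l (𝓝 y))
    (hC : ∀ t, ∃ C, ∀ r ∈ Icc 0 t, ‖T r‖ ≤ C) :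
    Tendsto (fun t : ℝ => t⁻¹ • (T t x - x)) (𝓝[>] 0) (𝓝 y) := by
  refine (hT.tendsto_average y).congr' ?_
  filter_upwards [self_mem_nhdsWithin] with t ht
  obtain ⟨C, hC⟩ := hC t
  rw [hT.apply_sub_eq_integral hh hxy (mem_Ioi.1 ht).le hC]

end IsC0Semigroup

lemma IsGenerator.mem_graph_iff {K : Type*} [NormedAddCommGroup K] [NormedSpace ℂ K]
    {T : ℝ → K →L[ℂ] K} {B : K →ₗ.[ℂ] K} (hB : IsGenerator T B) {x y : K} :
    (x, y) ∈ B.graph ↔ Tendsto (fun t : ℝ => t⁻¹ • (T t x - x)) (𝓝[>] 0) (𝓝 y) := by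
  rw [LinearPMap.mem_graph_iff]
  constructor
  · rintro ⟨z, rfl, rfl⟩
    exact hB.2 z
  · intro h
    exact ⟨⟨x, (hB.1 x).2 ⟨y, h⟩⟩, rfl, tendsto_nhds_unique (hB.2 _) h⟩

/-- Dominated convergence in `Lᵖ` along a countably generated filter. -/
lemma tendsto_Lp_of_dominated {Ω E ι : Type*} [MeasurableSpace Ω] {μ : Measure Ω}
    [NormedAddCommGroup E] {p : ENNReal} [Fact (1 ≤ p)] (hp : p ≠ ⊤) {l : Filter ι}
    [l.IsCountablyGenerated] {F : ι → Lp E p μ} {f : Lp E p μ} {b : Ω → ℝ} (hb : MemLp b p μ)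
    (hF : ∀ᶠ i in l, ∀ᵐ s ∂μ, ‖F i s - f s‖ ≤ b s)
    (hlim : ∀ᵐ s ∂μ, Tendsto (fun i => F i s) l (𝓝 (f s))) :
    Tendsto F l (𝓝 f) := by
  have hp0 : p ≠ 0 := (zero_lt_one.trans_le Fact.out).ne'
  have hpr : 0 < p.toReal := ENNReal.toReal_pos hp0 hp
  rw [Lp.tendsto_Lp_iff_tendsto_eLpNorm']
  simp only [eLpNorm_eq_lintegral_rpow_enorm_toReal hp0 hp]
  have key : Tendsto (fun i => ∫⁻ s, ‖(⇑(F i) - ⇑f) s‖ₑ ^ p.toReal ∂μ) l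
      (𝓝 (∫⁻ _, 0 ∂μ)) := by
    refine tendsto_lintegral_filter_of_dominated_convergence (fun s => ‖b s‖ₑ ^ p.toReal)
      (.of_forall fun i => ?_) ?_ ?_ ?_
    · exact (((Lp.stronglyMeasurable (F i)).sub
        (Lp.stronglyMeasurable f)).enorm.pow_const _)
    · filter_upwards [hF] with i hi
      filter_upwards [hi] with s hs
      refine ENNReal.rpow_le_rpow ?_ hpr.le
      exact enorm_le_iff_norm_le.2 (hs.trans (le_abs_self _))
    · exact (lintegral_rpow_enorm_lt_top_of_eLpNorm_lt_top hp0 hp hb.2).ne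
    · filter_upwards [hlim] with s hs
      have h1 : Tendsto (fun i => ‖F i s - f s‖ₑ) l (𝓝 0) := by
        rw [← tendsto_iff_enorm_sub_tendsto_zero]; exact hs
      simpa [hpr] using h1.ennrpow_const p.toReal
  simpa [hpr] using key.ennrpow_const (1 / p.toReal)

variable {Ω : Type*} [MeasurableSpace Ω] {μ : Measure Ω} [SigmaFinite μ]
variable {H : Type*} [NormedAddCommGroup H] [InnerProductSpace ℂ H] [CompleteSpace H]
  [TopologicalSpace.SeparableSpace H]

/-- If the fibre semigroups are uniformly a.e. exponentially bounded, so that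
`𝒯` is a `C₀`-semigroup, then the generator `𝒜` of `𝒯` is the direct integral of the fibre
generators `A s`: its domain consists of those `x ∈ L²(Ω, μ; H)` with `x s ∈ D(A s)` a.e. and
`s ↦ A s (x s)` in `L²(Ω, μ; H)` (expressed via graphs), and `(𝒜 x) s = A s (x s)` a.e. -/
theorem directIntegral_generator (T : Ω → ℝ → H →L[ℂ] H)
    (hsg : ∀ᵐ s ∂μ, IsC0Semigroup (T s))
    (hmeas : ∀ t : ℝ, 0 ≤ t → ∀ x : H, StronglyMeasurable fun s => T s t x)
    (M ω : ℝ) (hM : 1 ≤ M)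
    (hbdd : ∀ᵐ s ∂μ, ∀ t : ℝ, 0 ≤ t → ‖T s t‖ ≤ M * Real.exp (ω * t))
    (𝒯 : ℝ → Lp H 2 μ →L[ℂ] Lp H 2 μ)
    (h𝒯 : ∀ t : ℝ, 0 ≤ t → ∀ x : Lp H 2 μ, ⇑(𝒯 t x) =ᵐ[μ] fun s => T s t (x s))
    (h𝒯sg : IsC0Semigroup 𝒯)
    (As : Ω → H →ₗ.[ℂ] H) (hAs : ∀ᵐ s ∂μ, IsGenerator (T s) (As s))
    (𝒜 : Lp H 2 μ →ₗ.[ℂ] Lp H 2 μ) (h𝒜 : IsGenerator 𝒯 𝒜) :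
    ∀ x : Lp H 2 μ,
      (x ∈ 𝒜.domain ↔ ∃ g : Lp H 2 μ, ∀ᵐ s ∂μ, (x s, g s) ∈ (As s).graph) ∧
      ∀ hx : x ∈ 𝒜.domain, ∀ᵐ s ∂μ, (x s, (𝒜 ⟨x, hx⟩) s) ∈ (As s).graph := by
  intro x
  have hC : ∀ᵐ s ∂μ, ∀ t, ∀ r ∈ Icc 0 t, ‖T s r‖ ≤ M * Real.exp (|ω| * t) := by
    filter_upwards [hbdd] with s hs t r hr
    refine (hs r hr.1).trans ?_
    gcongr
    exacts [hr.1, le_abs_self ω, hr.2]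
  have hquot (t : ℝ) (ht : 0 ≤ t) : ∀ᵐ s ∂μ,
      (t⁻¹ • (𝒯 t x - x) : Lp H 2 μ) s = t⁻¹ • (T s t (x s) - x s) := by
    filter_upwards [h𝒯 t ht x, Lp.coeFn_smul ((t⁻¹ : ℝ) : ℂ) (𝒯 t x - x),
      Lp.coeFn_sub (𝒯 t x) x] with s h1 h2 h3
    rw [Pi.smul_apply, h3, Pi.sub_apply, h1, Complex.coe_smul] at h2
    exact h2
  have hgraph (y : Lp H 2 μ) :
      (x, y) ∈ 𝒜.graph ↔ ∀ᵐ s ∂μ, (x s, y s) ∈ (As s).graph := by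
    rw [h𝒜.mem_graph_iff]
    constructor
    · intro hy
      obtain ⟨u, hu0, hu⟩ : ∃ u : ℕ → ℝ, (∀ n, 0 < u n) ∧ Tendsto u atTop (𝓝[>] 0) := by
        obtain ⟨u, -, hu0, hu⟩ := exists_seq_strictAnti_tendsto (0 : ℝ)
        exact ⟨u, hu0, tendsto_nhdsWithin_iff.2 ⟨hu, .of_forall hu0⟩⟩
      obtain ⟨φ, hφ, hlim⟩ :=
        (tendstoInMeasure_of_tendsto_Lp (hy.comp hu)).exists_seq_tendsto_ae
      have hall := ae_all_iff.2 fun n => hquot (u n) (hu0 n).le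
      filter_upwards [hlim, hall, hsg, hAs, hC] with s h1 h2 h3 h4 h5
      refine h4.mem_graph_iff.2 (h3.tendsto_differenceQuotient (hu.comp hφ.tendsto_atTop) ?_
        fun t => ⟨_, h5 t⟩)
      exact h1.congr fun n => h2 (φ n)
    · intro hy
      have hb : MemLp (fun s => (M * Real.exp (|ω| * 1) + 1) * ‖y s‖) 2 μ :=
        (Lp.memLp y).norm.const_mul _
      refine tendsto_of_seq_tendsto fun u hu => tendsto_Lp_of_dominated (by simp) hb ?_ ?_
      · filter_upwards [hu.eventually (Ioo_mem_nhdsGT one_pos)] with n hn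
        filter_upwards [hquot (u n) hn.1.le, hy, hsg, hAs, hC] with s h1 h2 h3 h4 h5
        rw [add_mul, one_mul]
        refine (norm_sub_le _ _).trans (add_le_add_left ?_ _)
        refine (congrArg norm h1).trans_le ?_
        exact h3.norm_differenceQuotient_le (h4.mem_graph_iff.1 h2) hn.1
          fun r hr => h5 1 r ⟨hr.1, hr.2.trans hn.2.le⟩
      · have hall : ∀ᵐ s ∂μ, ∀ n, 0 < u n →
            ((u n)⁻¹ • (𝒯 (u n) x - x) : Lp H 2 μ) s =
              (u n)⁻¹ • (T s (u n) (x s) - x s) :=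
          ae_all_iff.2 fun n => eventually_imp_distrib_left.2 fun hn => hquot (u n) hn.le
        filter_upwards [hall, hy, hAs] with s h1 h2 h3
        refine ((h3.mem_graph_iff.1 h2).comp hu).congr' ?_
        filter_upwards [hu.eventually self_mem_nhdsWithin] with n hn
        exact (h1 n hn).symm
  refine ⟨⟨fun hx => ⟨𝒜 ⟨x, hx⟩, (hgraph _).1 (𝒜.mem_graph ⟨x, hx⟩)⟩, ?_⟩,
    fun hx => (hgraph _).1 (𝒜.mem_graph ⟨x, hx⟩)⟩
  rintro ⟨g, hg⟩
  exact LinearPMap.mem_domain_of_mem_graph ((hgraph g).2 hg)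
end
end

section
/- Suppose 𝒜 generates a C₀-semigroup (𝒯(t))_{t≥0} on L²(Ω, μ; H) satisfying ‖𝒯(t)‖ ≤ M e^{ωt} for all t ≥ 0, where M ≥ 1 and ω ∈ ℝ. Then for a.e. s ∈ Ω the operator A(s) generates a C₀-semigroup (T(s,t))_{t≥0} on H with ‖T(s,t)‖ ≤ M e^{ωt} for all t ≥ 0, and for every t ≥ 0 and every x ∈ L²(Ω, μ; H), (𝒯(t)x)(s) = T(s,t)x(s) for a.e. s ∈ Ω. -/
open MeasureTheory Filter Topology Set

noncomputable section

theorem hasDerivWithinAt_Ici_iff_tendsto {E : Type*} [NormedAddCommGroup E] [NormedSpace ℝ E]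
    {f : ℝ → E} {f' : E} {r : ℝ} :
    HasDerivWithinAt f f' (Ici r) r ↔
      Tendsto (fun h : ℝ => h⁻¹ • (f (r + h) - f r)) (𝓝[>] 0) (𝓝 f') := by
  have hmap : 𝓝[>] r = map (fun h => r + h) (𝓝[>] 0) := by
    simp
  rw [← hasDerivWithinAt_Ioi_iff_Ici, hasDerivWithinAt_iff_tendsto_slope' self_notMem_Ioi, hmap,
    tendsto_map'_iff]
  refine tendsto_congr fun h => ?_
  simp [slope]

/-- Strong convergence of a bounded family of operators is stable under converging arguments. -/
theorem tendsto_clm_apply_of_bounded {K ι : Type*} [NormedAddCommGroup K] [NormedSpace ℂ K]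
    {l : Filter ι} {L : ι → K →L[ℂ] K} {u : ι → K} {x y : K} {C : ℝ}
    (hL : ∀ᶠ i in l, ‖L i‖ ≤ C) (hx : Tendsto (fun i => L i x) l (𝓝 y)) (hu : Tendsto u l (𝓝 x)) :
    Tendsto (fun i => L i (u i)) l (𝓝 y) := by
  have h0 : Tendsto (fun i => C * ‖u i - x‖) l (𝓝 0) := by
    simpa using ((tendsto_iff_norm_sub_tendsto_zero.1 hu).const_mul C)
  have h1 : Tendsto (fun i => L i (u i - x)) l (𝓝 0) :=
    squeeze_zero_norm' (hL.mono fun i hi => (L i).le_of_opNorm_le hi _) h0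
  simpa using h1.add hx

theorem mul_exp_le_mul_exp_abs {M ω t r : ℝ} (hM : 0 ≤ M) (hr : 0 ≤ r) (hrt : r ≤ t) :
    M * Real.exp (ω * r) ≤ M * Real.exp (|ω| * t) := by
  gcongr
  exact le_abs_self ω

section Generator

variable {K : Type*} [NormedAddCommGroup K] [NormedSpace ℂ K] {T : ℝ → K →L[ℂ] K}
  {A : K →ₗ.[ℂ] K}

theorem IsGenerator.tendsto_of_mem_graph (hA : IsGenerator T A) {x y : K} (h : (x, y) ∈ A.graph) :
    Tendsto (fun t : ℝ => t⁻¹ • (T t x - x)) (𝓝[>] (0 : ℝ)) (𝓝 y) := by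
  obtain ⟨z, rfl, rfl⟩ := (LinearPMap.mem_graph_iff A).1 h
  exact hA.2 z

theorem IsGenerator.mem_graph_of_tendsto (hA : IsGenerator T A) {x y : K}
    (h : Tendsto (fun t : ℝ => t⁻¹ • (T t x - x)) (𝓝[>] (0 : ℝ)) (𝓝 y)) : (x, y) ∈ A.graph := by
  have hx : x ∈ A.domain := (hA.1 x).2 ⟨y, h⟩
  rw [tendsto_nhds_unique h (hA.2 ⟨x, hx⟩)]
  exact A.mem_graph ⟨x, hx⟩

theorem IsC0Semigroup.tendsto_apply_apply (hT : IsC0Semigroup T) {x y : K}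
    (h : Tendsto (fun t : ℝ => t⁻¹ • (T t x - x)) (𝓝[>] (0 : ℝ)) (𝓝 y)) {r : ℝ} (hr : 0 ≤ r) :
    Tendsto (fun t : ℝ => t⁻¹ • (T t (T r x) - T r x)) (𝓝[>] (0 : ℝ)) (𝓝 (T r y)) := by
  refine (((T r).continuous.tendsto y).comp h).congr' ?_
  filter_upwards [self_mem_nhdsWithin] with t ht
  have e : T t (T r x) = T r (T t x) := by
    have h1 := hT.2.1 t r (le_of_lt ht) hr
    have h2 := hT.2.1 r t hr (le_of_lt ht)
    rw [add_comm, h2] at h1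
    simpa using (congrArg (fun L => L x) h1).symm
  simp only [Function.comp_apply, e, ← Complex.coe_smul, map_smul, map_sub]

theorem IsC0Semigroup.hasDerivWithinAt (hT : IsC0Semigroup T) {x y : K}
    (h : Tendsto (fun t : ℝ => t⁻¹ • (T t x - x)) (𝓝[>] (0 : ℝ)) (𝓝 y)) {r : ℝ} (hr : 0 ≤ r) :
    HasDerivWithinAt (fun t => T t x) (T r y) (Ici r) r := by
  rw [hasDerivWithinAt_Ici_iff_tendsto]
  refine (hT.tendsto_apply_apply h hr).congr' ?_
  filter_upwards [self_mem_nhdsWithin] with t ht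
  rw [add_comm r t, hT.2.1 t r (le_of_lt ht) hr, ContinuousLinearMap.comp_apply]

theorem IsC0Semigroup.norm_sub_le (hT : IsC0Semigroup T) (hA : IsGenerator T A) {M ω : ℝ}
    (hM : 0 ≤ M) (hbound : ∀ t : ℝ, 0 ≤ t → ‖T t‖ ≤ M * Real.exp (ω * t))
    {x y : K} (h : (x, y) ∈ A.graph) {t : ℝ} (ht : 0 ≤ t) :
    ‖T t x - x‖ ≤ M * Real.exp (|ω| * t) * t * ‖y‖ := by
  have key := norm_image_sub_le_of_norm_deriv_right_le_segment (f := fun t => T t x)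
    (f' := fun r => T r y) (a := 0) (b := t) (C := M * Real.exp (|ω| * t) * ‖y‖)
    ((hT.2.2 x).mono Icc_subset_Ici_self)
    (fun r hr => hT.hasDerivWithinAt (hA.tendsto_of_mem_graph h) hr.1)
    (fun r hr => (T r).le_of_opNorm_le ((hbound r hr.1).trans
      (mul_exp_le_mul_exp_abs hM hr.1 hr.2.le)) y) t ⟨ht, le_rfl⟩
  simp only [hT.1, one_apply_eq_self, sub_zero] at key
  linarith

theorem IsC0Semigroup.norm_sub_sub_smul_le (hT : IsC0Semigroup T) (hA : IsGenerator T A)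
    {M ω : ℝ} (hM : 0 ≤ M) (hbound : ∀ t : ℝ, 0 ≤ t → ‖T t‖ ≤ M * Real.exp (ω * t))
    {x y z : K} (h : (x, y) ∈ A.graph) (h' : (y, z) ∈ A.graph) {t : ℝ} (ht : 0 ≤ t) :
    ‖T t x - x - t • y‖ ≤ M * Real.exp (|ω| * t) * t * t * ‖z‖ := by
  have key := norm_image_sub_le_of_norm_deriv_right_le_segment (f := fun t => T t x - t • y)
    (f' := fun r => T r y - y) (a := 0) (b := t) (C := M * Real.exp (|ω| * t) * t * ‖z‖)
    (((hT.2.2 x).mono Icc_subset_Ici_self).sub (by fun_prop))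
    (fun r hr => (hT.hasDerivWithinAt (hA.tendsto_of_mem_graph h) hr.1).sub
      (by simpa using ((hasDerivAt_id r).smul_const y).hasDerivWithinAt))
    (fun r hr => (hT.norm_sub_le hA hM hbound h' hr.1).trans (by
      have hr0 := hr.1
      have hrt := hr.2.le
      gcongr)) t ⟨ht, le_rfl⟩
  simp only [hT.1, one_apply_eq_self, sub_zero, zero_smul] at key
  rw [sub_right_comm]
  linarith

/-- The domain of the generator of a `C₀`-semigroup is dense. -/
theorem IsC0Semigroup.dense_domain [CompleteSpace K] (hT : IsC0Semigroup T)
    (hA : IsGenerator T A) : Dense (A.domain : Set K) := by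
  intro x
  set u : ℝ → K := fun r => T |r| x with hu
  have hcont : Continuous u :=
    (hT.2.2 x).comp_continuous continuous_abs fun r => abs_nonneg r
  have hint : ∀ a b, IntervalIntegrable u volume a b := fun a b => hcont.intervalIntegrable a b
  have hderiv : ∀ t, HasDerivAt (fun t => ∫ r in (0 : ℝ)..t, u r) (u t) t := fun t =>
    hcont.integral_hasStrictDerivAt 0 t |>.hasDerivAt
  have hmem : ∀ t : ℝ, 0 ≤ t → ∫ r in (0 : ℝ)..t, u r ∈ A.domain := by
    intro t ht
    refine (hA.1 _).2 ⟨u t - u 0, ?_⟩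
    have h1 := hasDerivWithinAt_Ici_iff_tendsto.1 (hderiv t).hasDerivWithinAt
    have h2 := hasDerivWithinAt_Ici_iff_tendsto.1 (hderiv 0).hasDerivWithinAt
    refine (h1.sub h2).congr' ?_
    filter_upwards [self_mem_nhdsWithin] with h hh
    have hh0 : 0 ≤ h := le_of_lt hh
    rw [← smul_sub]
    congr 1
    have e1 : T h (∫ r in (0 : ℝ)..t, u r) = ∫ r in (h : ℝ)..(t + h), u r := by
      rw [← ContinuousLinearMap.intervalIntegral_comp_comm _ (hint 0 t)]
      have : ∫ r in (0 : ℝ)..t, T h (u r) = ∫ r in (0 : ℝ)..t, u (r + h) := by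
        refine intervalIntegral.integral_congr fun r hr => ?_
        rw [uIcc_of_le ht] at hr
        have hr0 : 0 ≤ r := hr.1
        simp only [hu, abs_of_nonneg hr0, abs_of_nonneg (add_nonneg hr0 hh0)]
        rw [add_comm r h, hT.2.1 h r hh0 hr0, ContinuousLinearMap.comp_apply]
      rw [this, intervalIntegral.integral_comp_add_right, zero_add]
    rw [e1]
    have e2 := intervalIntegral.integral_add_adjacent_intervals (hint 0 h) (hint h (t + h))
    simp only [zero_add, intervalIntegral.integral_same, sub_zero, ← e2]
    abel
  have hlim := hasDerivWithinAt_Ici_iff_tendsto.1 (hderiv 0).hasDerivWithinAt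
  have hu0 : u 0 = x := by simp [hu, hT.1]
  rw [hu0] at hlim
  refine mem_closure_of_tendsto hlim ?_
  filter_upwards [self_mem_nhdsWithin] with t ht
  simp only [zero_add, intervalIntegral.integral_same, sub_zero, ← Complex.coe_smul]
  exact A.domain.smul_mem _ (hmem t (le_of_lt ht))

/-- A bounded operator leaving the generator invariant commutes with the semigroup. -/
theorem IsC0Semigroup.apply_comm [CompleteSpace K] (hT : IsC0Semigroup T)
    (hA : IsGenerator T A) {M ω : ℝ}
    (hM : 0 ≤ M) (hbound : ∀ t : ℝ, 0 ≤ t → ‖T t‖ ≤ M * Real.exp (ω * t)) (B : K →L[ℂ] K)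
    (hB : ∀ x y, (x, y) ∈ A.graph → (B x, B y) ∈ A.graph) {t : ℝ} (ht : 0 ≤ t) (x : K) :
    T t (B x) = B (T t x) := by
  have hbd : ∀ r ∈ Icc 0 t, ‖T r‖ ≤ M * Real.exp (|ω| * t) := fun r hr =>
    (hbound r hr.1).trans (mul_exp_le_mul_exp_abs hM hr.1 hr.2)
  refine (hT.dense_domain hA).induction (P := fun x => T t (B x) = B (T t x)) ?_
    (isClosed_eq (by fun_prop) (by fun_prop)) x
  intro x hx
  have hgraph := A.mem_graph ⟨x, hx⟩
  set y := A ⟨x, hx⟩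
  have key := constant_of_has_deriv_right_zero (f := fun r => T (t - r) (B (T r x)))
    (a := 0) (b := t) ?_ ?_ t ⟨ht, le_rfl⟩
  · simpa [hT.1] using key.symm
  · intro r hr
    refine tendsto_clm_apply_of_bounded (L := fun r => T (t - r)) (x := B (T r x))
      (C := M * Real.exp (|ω| * t)) ?_ ?_ ?_
    · filter_upwards [self_mem_nhdsWithin] with q hq
      exact hbd _ ⟨by linarith [hq.2], by linarith [hq.1]⟩
    · refine (hT.2.2 (B (T r x))).comp (by fun_prop) (s := Icc 0 t) (f := fun q => t - q) ?_ r hr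
      intro q hq
      simp only [mem_Ici]
      linarith [hq.2]
    · exact ((B.continuous.comp_continuousOn (hT.2.2 x)).mono Icc_subset_Ici_self) r hr
  · intro r hr
    rw [hasDerivWithinAt_Ici_iff_tendsto]
    have hz := hT.tendsto_apply_apply (hA.tendsto_of_mem_graph hgraph) hr.1
    have hBz := hA.tendsto_of_mem_graph (hB _ _ (hA.mem_graph_of_tendsto hz))
    have hdiff := (((B.continuous.tendsto _).comp hz).sub hBz).norm.const_mul
      (M * Real.exp (|ω| * t))
    simp only [sub_self, norm_zero, mul_zero] at hdiff
    refine squeeze_zero_norm' ?_ hdiff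
    filter_upwards [self_mem_nhdsWithin, mem_nhdsWithin_of_mem_nhds
      (Iio_mem_nhds (sub_pos.2 hr.2))] with h hh hht
    have hh0 : 0 ≤ h := le_of_lt hh
    have hht' : h < t - r := hht
    have e1 : T (t - r) = (T (t - (r + h))).comp (T h) := by
      rw [← hT.2.1 _ _ (by linarith) hh0]
      congr 1
      ring
    have e2 : T (r + h) = (T h).comp (T r) := by
      rw [add_comm, hT.2.1 h r hh0 hr.1]
    have e3 : h⁻¹ • (T (t - (r + h)) (B (T (r + h) x)) - T (t - r) (B (T r x))) =
        T (t - (r + h)) (B (h⁻¹ • (T h (T r x) - T r x)) - h⁻¹ • (T h (B (T r x)) - B (T r x))) := by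
      simp only [e1, e2, ContinuousLinearMap.comp_apply, ← Complex.coe_smul, map_smul, map_sub,
        ← smul_sub]
      congr 1
      abel
    rw [e3]
    exact (T _).le_of_opNorm_le (hbd _ ⟨by linarith, by linarith [hr.1]⟩) _

end Generator

theorem coe_nnratCast_nnreal (q : ℚ≥0) : ((q : NNReal) : ℝ) = q := rfl

theorem isDenseInducing_nnratCast : IsDenseInducing (fun q : ℚ≥0 => (q : NNReal)) where
  toIsInducing := by
    refine IsInducing.of_comp (g := ((↑) : NNReal → ℝ)) ?_ NNReal.continuous_coe ?_
    · rw [NNReal.isEmbedding_coe.isInducing.continuous_iff]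
      exact Rat.continuous_coe_real.comp continuous_subtype_val
    · exact Rat.isEmbedding_coe_real.isInducing.comp IsInducing.subtypeVal
  dense := by
    refine dense_of_exists_between fun a b hab => ?_
    obtain ⟨q, hq, haq, hqb⟩ := NNReal.lt_iff_exists_rat_btwn a b |>.1 hab
    lift q to ℚ≥0 using hq
    have e : Real.toNNReal ((q : ℚ) : ℝ) = q := by
      rw [Rat.cast_nnratCast, ← coe_nnratCast_nnreal, Real.toNNReal_coe]
    rw [e] at haq hqb
    exact ⟨q, ⟨q, rfl⟩, haq, hqb⟩

/-- A bounded net of operators converging pointwise on a dense set converges everywhere. -/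
theorem tendsto_clm_apply_of_dense {K ι : Type*} [NormedAddCommGroup K] [NormedSpace ℂ K]
    {l : Filter ι} {L : ι → K →L[ℂ] K} {L' : K →L[ℂ] K} {C : ℝ} (hL : ∀ᶠ i in l, ‖L i‖ ≤ C)
    {D : Set K} (hD : Dense D) (h : ∀ x ∈ D, Tendsto (fun i => L i x) l (𝓝 (L' x))) (x : K) :
    Tendsto (fun i => L i x) l (𝓝 (L' x)) := by
  rcases l.eq_or_neBot with rfl | hl
  · exact tendsto_bot
  have hC : 0 ≤ C := let ⟨i, hi⟩ := hL.exists; (norm_nonneg _).trans hi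
  rw [Metric.tendsto_nhds]
  intro ε hε
  have hpos : 0 < C + ‖L'‖ + 1 := by positivity
  obtain ⟨y, hyD, hy⟩ := hD.exists_dist_lt x (ε := ε / 2 / (C + ‖L'‖ + 1)) (by positivity)
  filter_upwards [hL, Metric.tendsto_nhds.1 (h y hyD) (ε / 2) (by positivity)] with i hi hiy
  rw [dist_eq_norm] at hy hiy ⊢
  have e : L i x - L' x = (L i - L') (x - y) + (L i y - L' y) := by
    simp only [sub_apply, map_sub]
    abel
  have h1 : ‖(L i - L') (x - y)‖ ≤ (C + ‖L'‖ + 1) * ‖x - y‖ :=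
    (L i - L').le_of_opNorm_le ((norm_sub_le _ _).trans (by linarith)) _
  have h2 : (C + ‖L'‖ + 1) * ‖x - y‖ < ε / 2 := by
    rw [lt_div_iff₀ hpos] at hy
    linarith
  rw [e]
  exact (norm_add_le _ _).trans_lt (by linarith)

/-- A semigroup indexed by `ℚ≥0`, with the growth and differentiability properties on the range of
`R` that a semigroup generated by `A` must have, extends to a `C₀`-semigroup generated by `A`. -/
theorem exists_c0Semigroup_of_nnrat {K : Type*} [NormedAddCommGroup K] [NormedSpace ℂ K]
    [CompleteSpace K] {A : K →ₗ.[ℂ] K} {ν : ℂ} {R : K →L[ℂ] K} (hR : ResolventAt A ν R)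
    (hdense : DenseRange R) (S : ℚ≥0 → K →L[ℂ] K) {M ω : ℝ} (hM : 0 ≤ M) (hS0 : S 0 = 1)
    (hSadd : ∀ p q, S (p + q) = (S p).comp (S q))
    (hSnorm : ∀ q : ℚ≥0, ‖S q‖ ≤ M * Real.exp (ω * q))
    (hcomm : ∀ (q : ℚ≥0) h, S q (R h) = R (S q h))
    (h1 : ∀ (q : ℚ≥0) h,
      ‖S q (R h) - R h‖ ≤ M * Real.exp (|ω| * q) * q * ‖ν • R h - h‖)
    (h2 : ∀ (q : ℚ≥0) h, ‖S q (R (R h)) - R (R h) - (q : ℝ) • (ν • R (R h) - R h)‖ ≤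
      M * Real.exp (|ω| * q) * q * q * ‖ν • (ν • R (R h) - R h) - (ν • R h - h)‖) :
    ∃ T : ℝ → K →L[ℂ] K, IsC0Semigroup T ∧ IsGenerator T A ∧
      (∀ t : ℝ, 0 ≤ t → ‖T t‖ ≤ M * Real.exp (ω * t)) ∧ ∀ q : ℚ≥0, T q = S q := by
  have di := isDenseInducing_nnratCast
  have hlip : ∀ (p q : ℚ≥0) h, ‖S p (R h) - S q (R h)‖ ≤
      M * M * Real.exp (|ω| * (p + q)) * |(p : ℝ) - q| * ‖ν • R h - h‖ := by
    intro p q h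
    wlog hqp : q ≤ p generalizing p q
    · rw [norm_sub_rev, abs_sub_comm, add_comm (p : ℝ)]
      exact this q p (le_of_not_ge hqp)
    obtain ⟨r, rfl⟩ := exists_add_of_le hqp
    have e : S (q + r) (R h) - S q (R h) = S q (S r (R h) - R h) := by
      rw [hSadd, ContinuousLinearMap.comp_apply, map_sub]
    have hr : (0 : ℝ) ≤ r := by positivity
    have hq : (0 : ℝ) ≤ q := by positivity
    rw [e]
    refine ((S q).le_of_opNorm_le_of_le (hSnorm q) (h1 r h)).trans ?_
    have e2 : |((q + r : ℚ≥0) : ℝ) - q| = r := by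
      push_cast
      rw [add_sub_cancel_left, abs_of_nonneg hr]
    have e3 : Real.exp (ω * q) * Real.exp (|ω| * r) ≤
        Real.exp (|ω| * (((q + r : ℚ≥0) : ℝ) + q)) := by
      rw [← Real.exp_add]
      refine Real.exp_le_exp.2 ?_
      push_cast
      nlinarith [le_abs_self ω, abs_nonneg ω]
    rw [e2]
    calc M * Real.exp (ω * q) * (M * Real.exp (|ω| * r) * r * ‖ν • R h - h‖)
        = M * M * (Real.exp (ω * q) * Real.exp (|ω| * r)) * r * ‖ν • R h - h‖ := by ring
      _ ≤ _ := by gcongr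
  have hcast : ∀ t : NNReal,
      Tendsto (fun q : ℚ≥0 => (q : ℝ)) (comap (fun q : ℚ≥0 => (q : NNReal)) (𝓝 t)) (𝓝 t) :=
    fun t => ((NNReal.continuous_coe.tendsto t).comp tendsto_comap).congr coe_nnratCast_nnreal
  have hlim : ∀ (x : K) (t : NNReal),
      ∃ c, Tendsto (fun q => S q x) (comap (fun q : ℚ≥0 => (q : NNReal)) (𝓝 t)) (𝓝 c) := by
    intro x t
    have := di.comap_nhds_neBot t
    set l := comap (fun q : ℚ≥0 => (q : NNReal)) (𝓝 t)
    have hl : ∀ᶠ q : ℚ≥0 in l, ‖S q‖ ≤ M * Real.exp (|ω| * (t + 1)) := by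
      filter_upwards [(hcast t).eventually (Iic_mem_nhds (lt_add_one (t : ℝ)))] with q hq
      exact (hSnorm q).trans (mul_exp_le_mul_exp_abs hM (by positivity) hq)
    refine cauchy_map_iff_exists_tendsto.1 (cauchy_map_iff'.2 ?_)
    rw [tendsto_uniformity_iff_dist_tendsto_zero]
    have hfst := (hcast t).comp (tendsto_fst (f := l) (g := l))
    have hsnd := (hcast t).comp (tendsto_snd (f := l) (g := l))
    have key := tendsto_clm_apply_of_dense (l := l ×ˢ l) (L := fun p => S p.1 - S p.2) (L' := 0)
      (C := M * Real.exp (|ω| * (t + 1)) + M * Real.exp (|ω| * (t + 1))) ?_ hdense ?_ x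
    · simpa [dist_eq_norm] using key.norm
    · filter_upwards [hl.prod_mk hl] with p hp
      exact (norm_sub_le _ _).trans (add_le_add hp.1 hp.2)
    · rintro _ ⟨h, rfl⟩
      refine squeeze_zero_norm (fun p => hlip p.1 p.2 h) ?_
      have hc : Continuous fun p : ℝ × ℝ =>
          M * M * Real.exp (|ω| * (p.1 + p.2)) * |p.1 - p.2| * ‖ν • R h - h‖ := by fun_prop
      simpa [Function.comp_def] using (hc.tendsto ((t : ℝ), (t : ℝ))).comp (hfst.prodMk_nhds hsnd)
  set U : K → NNReal → K := fun x => di.extend fun q => S q x with hU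
  have hUc : ∀ x, Continuous (U x) := fun x => di.continuous_extend (hlim x)
  have hUq : ∀ x (q : ℚ≥0), U x q = S q x := fun x q => di.extend_eq' (hlim x) q
  have hUadd : ∀ x y t, U (x + y) t = U x t + U y t := fun x y t =>
    di.dense.induction_on (p := fun t => U (x + y) t = U x t + U y t) t
      (isClosed_eq (hUc _) ((hUc _).add (hUc _))) fun q => by simp only [hUq, map_add]
  have hUsmul : ∀ (c : ℂ) x t, U (c • x) t = c • U x t := fun c x t =>
    di.dense.induction_on (p := fun t => U (c • x) t = c • U x t) t
      (isClosed_eq (hUc _) ((hUc _).const_smul c)) fun q => by simp only [hUq, map_smul]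
  have hUnorm : ∀ x (t : NNReal), ‖U x t‖ ≤ M * Real.exp (ω * t) * ‖x‖ := fun x t =>
    di.dense.induction_on (p := fun t : NNReal => ‖U x t‖ ≤ M * Real.exp (ω * t) * ‖x‖) t
      (isClosed_le (hUc _).norm (by fun_prop)) fun q => by
        rw [hUq]
        exact (S q).le_of_opNorm_le (hSnorm q) x
  set T : ℝ → K →L[ℂ] K := fun t => LinearMap.mkContinuous
    { toFun := fun x => U x t.toNNReal
      map_add' := fun x y => hUadd x y _
      map_smul' := fun c x => hUsmul c x _ } (M * Real.exp (ω * t.toNNReal))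
      (fun x => hUnorm x _) with hT
  have hTU : ∀ (t : NNReal) x, T t x = U x t := fun t x => by simp [hT]
  have hTq : ∀ q : ℚ≥0, T q = S q := fun q => by
    ext x
    rw [← hUq, ← hTU, coe_nnratCast_nnreal]
  have hTc : ∀ x, Continuous fun t => T t x := fun x =>
    (hUc x).comp continuous_real_toNNReal
  have hTq' : ∀ (q : ℚ≥0), T ((q : NNReal) : ℝ) = S q := fun q => by
    rw [← hTq, coe_nnratCast_nnreal]
  have hTnorm : ∀ t : ℝ, 0 ≤ t → ‖T t‖ ≤ M * Real.exp (ω * t) := by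
    intro t ht
    lift t to NNReal using ht
    refine ContinuousLinearMap.opNorm_le_bound _ (by positivity) fun x => ?_
    rw [hTU]
    exact hUnorm x t
  have hsg : IsC0Semigroup T := by
    refine ⟨by simpa [hS0] using hTq 0, ?_, fun x => (hTc x).continuousOn⟩
    intro t u ht hu
    lift t to NNReal using ht
    lift u to NNReal using hu
    ext x
    rw [ContinuousLinearMap.comp_apply]
    refine di.dense.induction_on (p := fun u : NNReal => T (t + u) x = T t (T u x)) u
      (isClosed_eq ((hTc x).comp (by fun_prop))
        ((T t).continuous.comp ((hTc x).comp (by fun_prop)))) fun q => ?_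
    refine di.dense.induction_on
      (p := fun t : NNReal => T (t + (q : NNReal)) x = T t (T (q : NNReal) x)) t
      (isClosed_eq ((hTc x).comp (by fun_prop)) ((hTc _).comp (by fun_prop))) fun p => ?_
    rw [hTq', hTq', ← ContinuousLinearMap.comp_apply, ← hSadd, ← hTq']
    congr 2
    simp
  have hTcomm : ∀ t : ℝ, 0 ≤ t → ∀ h, T t (R h) = R (T t h) := by
    intro t ht h
    lift t to NNReal using ht
    exact di.dense.induction_on (p := fun t : NNReal => T t (R h) = R (T t h)) t
      (isClosed_eq ((hTc _).comp (by fun_prop))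
        (R.continuous.comp ((hTc _).comp (by fun_prop)))) fun q => by rw [hTq', hcomm]
  have hT1 : ∀ t : ℝ, 0 ≤ t → ∀ h,
      ‖T t (R h) - R h‖ ≤ M * Real.exp (|ω| * t) * t * ‖ν • R h - h‖ := by
    intro t ht h
    lift t to NNReal using ht
    exact di.dense.induction_on (p := fun t : NNReal =>
      ‖T t (R h) - R h‖ ≤ M * Real.exp (|ω| * t) * t * ‖ν • R h - h‖) t
      (isClosed_le (((hTc _).comp NNReal.continuous_coe).sub continuous_const).norm
        (by fun_prop)) fun q => by
      rw [hTq']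
      exact h1 q h
  have hT2 : ∀ t : ℝ, 0 ≤ t → ∀ h, ‖T t (R (R h)) - R (R h) - t • (ν • R (R h) - R h)‖ ≤
      M * Real.exp (|ω| * t) * t * t * ‖ν • (ν • R (R h) - R h) - (ν • R h - h)‖ := by
    intro t ht h
    lift t to NNReal using ht
    exact di.dense.induction_on (p := fun t : NNReal =>
      ‖T t (R (R h)) - R (R h) - (t : ℝ) • (ν • R (R h) - R h)‖ ≤
      M * Real.exp (|ω| * t) * t * t * ‖ν • (ν • R (R h) - R h) - (ν • R h - h)‖) t
      (isClosed_le ((((hTc _).comp NNReal.continuous_coe).sub continuous_const).sub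
        (by fun_prop)).norm (by fun_prop)) fun q => by
      rw [hTq']
      exact h2 q h
  have hone : ∀ᶠ t : ℝ in 𝓝[>] 0, t ∈ Ioo (0 : ℝ) 1 := Ioo_mem_nhdsGT one_pos
  have hderiv : ∀ h, Tendsto (fun t : ℝ => t⁻¹ • (T t (R h) - R h)) (𝓝[>] 0)
      (𝓝 (ν • R h - h)) := by
    intro h
    have key := tendsto_clm_apply_of_dense (l := 𝓝[>] (0 : ℝ))
      (L := fun t : ℝ => (t⁻¹ : ℂ) • ((T t).comp R - R)) (L' := ν • R - 1)
      (C := M * Real.exp |ω| * ‖ν • R - 1‖) ?_ hdense ?_ h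
    · simpa [← Complex.ofReal_inv] using key
    · filter_upwards [hone] with t ht
      refine ContinuousLinearMap.opNorm_le_bound _ (by positivity) fun x => ?_
      have ht0 := ht.1
      have ht1 := ht.2.le
      have hx : ‖ν • R x - x‖ ≤ ‖ν • R - 1‖ * ‖x‖ := (ν • R - 1).le_opNorm x
      have hb : ‖T t (R x) - R x‖ ≤ t * (M * Real.exp |ω| * ‖ν • R - 1‖ * ‖x‖) :=
        calc _ ≤ _ := hT1 t ht0.le x
          _ ≤ M * Real.exp (|ω| * 1) * t * (‖ν • R - 1‖ * ‖x‖) := by gcongr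
          _ = _ := by ring_nf
      simp only [smul_apply, sub_apply,
        ContinuousLinearMap.comp_apply, norm_smul, norm_inv, Complex.norm_real, Real.norm_eq_abs,
        abs_of_pos ht0]
      rwa [inv_mul_le_iff₀ ht0]
    · rintro _ ⟨z, rfl⟩
      rw [tendsto_iff_norm_sub_tendsto_zero]
      set c := ‖ν • (ν • R (R z) - R z) - (ν • R z - z)‖
      have h0 : Tendsto (fun t : ℝ => M * Real.exp (|ω| * t) * t * c) (𝓝[>] 0) (𝓝 0) := by
        have hc : Continuous fun t : ℝ => M * Real.exp (|ω| * t) * t * c := by fun_prop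
        simpa using (hc.tendsto 0).mono_left nhdsWithin_le_nhds
      refine squeeze_zero' (Eventually.of_forall fun t => norm_nonneg _) ?_ h0
      filter_upwards [hone] with t ht
      have ht0 := ht.1
      have e : ((t⁻¹ : ℂ) • ((T t).comp R - R)) (R z) - (ν • R - 1) (R z) =
          t⁻¹ • (T t (R (R z)) - R (R z) - t • (ν • R (R z) - R z)) := by
        rw [smul_sub _ _ (t • _), inv_smul_smul₀ ht0.ne', ← Complex.coe_smul]
        simp
      rw [e, norm_smul, norm_inv, Real.norm_eq_abs, abs_of_pos ht0, inv_mul_le_iff₀ ht0]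
      exact (hT2 t ht0.le z).trans_eq (by ring)
  have hval : ∀ x : A.domain, Tendsto (fun t : ℝ => t⁻¹ • (T t (x : K) - (x : K))) (𝓝[>] (0:ℝ))
      (𝓝 (A x)) := by
    intro x
    simpa [hR.2 x] using hderiv (ν • (x : K) - A x)
  refine ⟨T, hsg, ⟨fun x => ⟨fun hx => ⟨_, hval ⟨x, hx⟩⟩, ?_⟩, hval⟩, hTnorm, hTq⟩
  rintro ⟨y, hy⟩
  have hRy : R y = ν • R x - x := by
    refine tendsto_nhds_unique (((R.continuous.tendsto y).comp hy).congr' ?_) (hderiv x)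
    filter_upwards [self_mem_nhdsWithin] with t ht
    simp only [Function.comp_apply, hTcomm t (le_of_lt ht), ← Complex.coe_smul, map_smul, map_sub]
  have hx : R (ν • x - y) = x := by
    rw [map_sub, map_smul, hRy]
    abel
  rw [← hx]
  exact (hR.1 _).1

/-- An approximately linear, Lipschitz function on a dense sequence extends to a bounded operator. -/
theorem exists_clm_of_dense {K : Type*} [NormedAddCommGroup K] [NormedSpace ℂ K] [CompleteSpace K]
    {d : ℕ → K} (hd : DenseRange d) {q : ℕ → ℂ} (hq : DenseRange q) {f : ℕ → K} {C : ℝ}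
    (hC : 0 ≤ C)
    (h : ∀ i j k m, ‖f i + q m • f j - f k‖ ≤ C * ‖d i + q m • d j - d k‖) :
    ∃ F : K →L[ℂ] K, ‖F‖ ≤ C ∧ ∀ n, F (d n) = f n := by
  have hc : ∀ (c : ℂ) i j k, ‖f i + c • f j - f k‖ ≤ C * ‖d i + c • d j - d k‖ := fun c i j k =>
    hq.induction_on (p := fun c : ℂ => ‖f i + c • f j - f k‖ ≤ C * ‖d i + c • d j - d k‖) c
      (isClosed_le (by fun_prop) (by fun_prop)) fun m => h i j k m
  have hlip : ∀ i k, ‖f i - f k‖ ≤ C * ‖d i - d k‖ := fun i k => by simpa using hc 0 i i k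
  have hne : ∀ x, (comap d (𝓝 x)).NeBot := fun x =>
    comap_neBot fun U hU =>
      let ⟨_, hyU, n, hn⟩ := mem_closure_iff_nhds.1 (hd x) U hU
      ⟨n, hn ▸ hyU⟩
  have hlim : ∀ x, ∃ y, Tendsto f (comap d (𝓝 x)) (𝓝 y) := by
    intro x
    have := hne x
    refine cauchy_map_iff_exists_tendsto.1 (cauchy_map_iff'.2 ?_)
    rw [tendsto_uniformity_iff_dist_tendsto_zero]
    have hfst := (tendsto_comap (f := d) (x := 𝓝 x)).comp
      (tendsto_fst (f := comap d (𝓝 x)) (g := comap d (𝓝 x)))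
    have hsnd := (tendsto_comap (f := d) (x := 𝓝 x)).comp
      (tendsto_snd (f := comap d (𝓝 x)) (g := comap d (𝓝 x)))
    refine squeeze_zero (g := fun p => C * ‖d p.1 - d p.2‖) (fun p => dist_nonneg)
      (fun p => (dist_eq_norm _ _).trans_le (hlip p.1 p.2)) ?_
    simpa using ((hfst.sub hsnd).norm.const_mul C)
  choose g hg using hlim
  have hgc : ∀ (c : ℂ) x y z, ‖g x + c • g y - g z‖ ≤ C * ‖x + c • y - z‖ := by
    intro c x y z
    have := hne x
    have := hne y
    have := hne z
    have h1 := tendsto_fst (f := comap d (𝓝 x)) (g := comap d (𝓝 y) ×ˢ comap d (𝓝 z))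
    have h2 := (tendsto_fst (f := comap d (𝓝 y)) (g := comap d (𝓝 z))).comp
      (tendsto_snd (f := comap d (𝓝 x)) (g := comap d (𝓝 y) ×ˢ comap d (𝓝 z)))
    have h3 := (tendsto_snd (f := comap d (𝓝 y)) (g := comap d (𝓝 z))).comp
      (tendsto_snd (f := comap d (𝓝 x)) (g := comap d (𝓝 y) ×ˢ comap d (𝓝 z)))
    exact le_of_tendsto_of_tendsto'
      ((((hg x).comp h1).add (((hg y).comp h2).const_smul c)).sub ((hg z).comp h3)).norm
      ((((tendsto_comap.comp h1).add ((tendsto_comap.comp h2).const_smul c)).sub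
        (tendsto_comap.comp h3)).norm.const_mul C) fun p => hc c _ _ _
  have hlin : ∀ (c : ℂ) x y, g (x + c • y) = g x + c • g y := fun c x y => by
    simpa [sub_eq_zero, eq_comm] using hgc c x y (x + c • y)
  have h0 : g 0 = 0 := by simpa using hgc 1 0 0 0
  refine ⟨LinearMap.mkContinuous
    { toFun := g
      map_add' := fun x y => by simpa using hlin 1 x y
      map_smul' := fun c x => by simpa [h0] using hlin c 0 x } C
      (fun x => by simpa [h0] using hgc 0 x 0 0), LinearMap.mkContinuous_norm_le _ hC _,
      fun n => ?_⟩
  have := hne (d n)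
  refine tendsto_nhds_unique (hg (d n)) ?_
  rw [tendsto_iff_norm_sub_tendsto_zero]
  refine squeeze_zero (fun k => norm_nonneg _) (fun k => hlip k n) ?_
  simpa using (((tendsto_comap (f := d) (x := 𝓝 (d n))).sub_const (d n)).norm.const_mul C)

section Decomposes

variable {Ω : Type*} [MeasurableSpace Ω] {μ : Measure Ω} {H : Type*} [NormedAddCommGroup H]
  [InnerProductSpace ℂ H]

/-- The operator `B` on `L²(Ω, μ; H)` acts fibrewise as the field of operators `F`. -/
def Decomposes (B : Lp H 2 μ →L[ℂ] Lp H 2 μ) (F : Ω → H →L[ℂ] H) : Prop :=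
  ∀ x : Lp H 2 μ, ⇑(B x) =ᵐ[μ] fun s => F s (x s)

theorem Decomposes.one : Decomposes (1 : Lp H 2 μ →L[ℂ] Lp H 2 μ) fun _ => 1 :=
  fun x => by simp

theorem Decomposes.sub {B B' : Lp H 2 μ →L[ℂ] Lp H 2 μ} {F F' : Ω → H →L[ℂ] H}
    (h : Decomposes B F) (h' : Decomposes B' F') : Decomposes (B - B') fun s => F s - F' s := by
  intro x
  filter_upwards [h x, h' x, Lp.coeFn_sub (B x) (B' x)] with s h1 h2 h3
  rw [sub_apply, h3, Pi.sub_apply, h1, h2, sub_apply]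

theorem Decomposes.smul {B : Lp H 2 μ →L[ℂ] Lp H 2 μ} {F : Ω → H →L[ℂ] H}
    (h : Decomposes B F) (c : ℂ) : Decomposes (c • B) fun s => c • F s := by
  intro x
  filter_upwards [h x, Lp.coeFn_smul c (B x)] with s h1 h2
  rw [smul_apply, h2, Pi.smul_apply, h1, smul_apply]

theorem Decomposes.comp {B B' : Lp H 2 μ →L[ℂ] Lp H 2 μ} {F F' : Ω → H →L[ℂ] H}
    (h : Decomposes B F) (h' : Decomposes B' F') :
    Decomposes (B.comp B') fun s => (F s).comp (F' s) := by
  intro x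
  filter_upwards [h (B' x), h' x] with s h1 h2
  simp [h1, h2]

/-- Multiplication by a bounded, strongly measurable field of operators. -/
theorem exists_decomposes [CompleteSpace H] [TopologicalSpace.SeparableSpace H]
    {F : Ω → H →L[ℂ] H}
    (hmeas : ∀ x : H, StronglyMeasurable fun s => F s x) {C : ℝ} (hC : ∀ᵐ s ∂μ, ‖F s‖ ≤ C) :
    ∃ B : Lp H 2 μ →L[ℂ] Lp H 2 μ, Decomposes B F := by
  borelize H
  have : SecondCountableTopology H := UniformSpace.secondCountable_of_separable H
  have hjoint : StronglyMeasurable (Function.uncurry fun (x : H) s => F s x) :=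
    stronglyMeasurable_uncurry_of_continuous_of_stronglyMeasurable
      (fun s => (F s).continuous) hmeas
  have hle : ∀ x : Lp H 2 μ, ∀ᵐ s ∂μ, ‖F s (x s)‖ ≤ C * ‖x s‖ := fun x =>
    hC.mono fun s hs => (F s).le_of_opNorm_le hs _
  have hmem : ∀ x : Lp H 2 μ, MemLp (fun s => F s (x s)) 2 μ := fun x =>
    (Lp.memLp x).of_le_mul
      (hjoint.comp_measurable
        ((Lp.stronglyMeasurable x).measurable.prodMk measurable_id)).aestronglyMeasurable (hle x)
  refine ⟨LinearMap.mkContinuous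
    { toFun := fun x => (hmem x).toLp
      map_add' := fun x y => by
        ext1
        filter_upwards [(hmem (x + y)).coeFn_toLp, (hmem x).coeFn_toLp, (hmem y).coeFn_toLp,
          Lp.coeFn_add x y, Lp.coeFn_add (hmem x).toLp (hmem y).toLp] with s h1 h2 h3 h4 h5
        rw [h1, h5, Pi.add_apply, h2, h3, h4, Pi.add_apply, map_add]
      map_smul' := fun c x => by
        ext1
        filter_upwards [(hmem (c • x)).coeFn_toLp, (hmem x).coeFn_toLp,
          Lp.coeFn_smul c x, Lp.coeFn_smul c (hmem x).toLp] with s h1 h2 h3 h4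
        rw [h1, RingHom.id_apply, h4, Pi.smul_apply, h2, h3, Pi.smul_apply, map_smul] } C fun x => ?_, fun x => (hmem x).coeFn_toLp⟩
  refine Lp.norm_le_mul_norm_of_ae_le_mul ?_
  filter_upwards [hle x, (hmem x).coeFn_toLp] with s h1 h2
  simpa [h2] using h1

theorem exists_decomposes_indicator [CompleteSpace H] [TopologicalSpace.SeparableSpace H]
    {E : Set Ω} (hE : MeasurableSet E) :
    ∃ P : Lp H 2 μ →L[ℂ] Lp H 2 μ, Decomposes P (E.indicator fun _ => 1) := by
  refine exists_decomposes (C := 1) (fun x => ?_) (Eventually.of_forall fun s => ?_)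
  · have e : (fun s => E.indicator (fun _ => (1 : H →L[ℂ] H)) s x) = E.indicator fun _ => x := by
      ext s
      by_cases hs : s ∈ E <;> simp [hs]
    rw [e]
    exact stronglyMeasurable_const.indicator hE
  · by_cases hs : s ∈ E
    · rw [indicator_of_mem hs]
      exact ContinuousLinearMap.norm_id_le
    · simp [hs]

theorem Decomposes.enorm_sq_eq_setLIntegral {E : Set Ω} (hE : MeasurableSet E)
    {P : Lp H 2 μ →L[ℂ] Lp H 2 μ} (hP : Decomposes P (E.indicator fun _ => 1)) (x : Lp H 2 μ) :
    ‖P x‖ₑ ^ (2 : ℝ) = ∫⁻ s in E, ‖x s‖ₑ ^ (2 : ℝ) ∂μ := by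
  have e : ⇑(P x) =ᵐ[μ] E.indicator x := by
    filter_upwards [hP x] with s hs
    rw [hs]
    by_cases hsE : s ∈ E <;> simp [hsE]
  rw [Lp.enorm_def, eLpNorm_congr_ae e, eLpNorm_indicator_eq_eLpNorm_restrict hE]
  exact eLpNorm_nnreal_pow_eq_lintegral (p := 2) two_ne_zero

/-- A norm inequality valid on all measurable restrictions holds pointwise. -/
theorem ae_norm_le_of_forall_indicator [SigmaFinite μ] [CompleteSpace H]
    [TopologicalSpace.SeparableSpace H] {X Y : Lp H 2 μ} {C : ℝ} (hC : 0 ≤ C)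
    (h : ∀ E, MeasurableSet E → ∀ P : Lp H 2 μ →L[ℂ] Lp H 2 μ,
      Decomposes P (E.indicator fun _ => 1) → ‖P X‖ ≤ C * ‖P Y‖) :
    ∀ᵐ s ∂μ, ‖X s‖ ≤ C * ‖Y s‖ := by
  have hXm := (Lp.stronglyMeasurable X).enorm
  have hYm := (Lp.stronglyMeasurable Y).enorm
  have key : (fun s => ‖X s‖ₑ ^ (2 : ℝ)) ≤ᵐ[μ]
      fun s => ENNReal.ofReal C ^ (2 : ℝ) * ‖Y s‖ₑ ^ (2 : ℝ) := by
    refine ae_le_of_forall_setLIntegral_le_of_sigmaFinite (hXm.pow_const _) fun E hE _ => ?_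
    obtain ⟨P, hP⟩ := exists_decomposes_indicator (μ := μ) (H := H) hE
    rw [lintegral_const_mul _ (hYm.pow_const _), ← hP.enorm_sq_eq_setLIntegral hE,
      ← hP.enorm_sq_eq_setLIntegral hE, ← ENNReal.mul_rpow_of_nonneg _ _ zero_le_two]
    gcongr
    rw [← ofReal_norm, ← ofReal_norm, ← ENNReal.ofReal_mul hC]
    exact ENNReal.ofReal_le_ofReal (h E hE P hP)
  filter_upwards [key] with s hs
  rw [← ENNReal.mul_rpow_of_nonneg _ _ zero_le_two, ENNReal.rpow_le_rpow_iff zero_lt_two,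
    ← ofReal_norm, ← ofReal_norm, ← ENNReal.ofReal_mul hC,
    ENNReal.ofReal_le_ofReal_iff (by positivity)] at hs
  exact hs

theorem exists_weight_memLp (μ : Measure Ω) [SigmaFinite μ] (H : Type*) [NormedAddCommGroup H]
    [InnerProductSpace ℂ H] :
    ∃ c : Ω → ℂ, (∀ s, c s ≠ 0) ∧ ∀ h : H, MemLp (fun s => c s • h) 2 μ := by
  obtain ⟨g, hg0, hgm, hg⟩ := exists_pos_lintegral_lt_of_sigmaFinite μ one_ne_zero
  refine ⟨fun s => (Real.sqrt (g s) : ℝ), fun s => ?_, fun h => ?_⟩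
  · have := hg0 s
    simpa [Real.sqrt_eq_zero'] using this.ne'
  · have hm : Measurable fun s => ((Real.sqrt (g s) : ℝ) : ℂ) := by fun_prop
    have hc : MemLp (fun s => ((Real.sqrt (g s) : ℝ) : ℂ)) 2 μ := by
      refine ⟨hm.aestronglyMeasurable, ?_⟩
      rw [eLpNorm_lt_top_iff_lintegral_rpow_enorm_lt_top two_ne_zero ENNReal.ofNat_ne_top]
      refine lt_of_le_of_lt (le_of_eq (lintegral_congr fun s => ?_)) (hg.trans ENNReal.one_lt_top)
      rw [← ofReal_norm, Complex.norm_real, Real.norm_of_nonneg (Real.sqrt_nonneg _),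
        ENNReal.toReal_ofNat, ENNReal.rpow_ofNat, ← ENNReal.ofReal_pow (Real.sqrt_nonneg _),
        Real.sq_sqrt (g s).coe_nonneg, ENNReal.ofReal_coe_nnreal]
    refine hc.of_le_mul (c := ‖h‖) ?_ (Eventually.of_forall fun s => ?_)
    · exact (hm.stronglyMeasurable.smul_const h).aestronglyMeasurable
    · rw [norm_smul, mul_comm]

/-- If a dense subspace of `L²` takes its values in subspaces `D s`, almost every `D s` is dense. -/
theorem ae_dense_of_dense [SigmaFinite μ] [TopologicalSpace.SeparableSpace H]
    {V : Set (Lp H 2 μ)} (hV : Dense V) {D : Ω → Submodule ℂ H}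
    (h : ∀ x ∈ V, ∀ᵐ s ∂μ, x s ∈ D s) : ∀ᵐ s ∂μ, Dense (D s : Set H) := by
  obtain ⟨c, hc0, hc⟩ := exists_weight_memLp μ H
  have key : ∀ n, ∀ᵐ s ∂μ, TopologicalSpace.denseSeq H n ∈ (D s).topologicalClosure := by
    intro n
    obtain ⟨v, hv, hlim⟩ :=
      mem_closure_iff_seq_limit.1 (hV (hc (TopologicalSpace.denseSeq H n)).toLp)
    obtain ⟨ns, -, hns⟩ := (tendstoInMeasure_of_tendsto_Lp hlim).exists_seq_tendsto_ae
    filter_upwards [hns, (hc (TopologicalSpace.denseSeq H n)).coeFn_toLp,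
      ae_all_iff.2 fun k => h (v k) (hv k)] with s h1 h2 h3
    rw [h2] at h1
    have h4 : c s • TopologicalSpace.denseSeq H n ∈ (D s).topologicalClosure :=
      mem_closure_of_tendsto h1 (Eventually.of_forall fun k => h3 (ns k))
    simpa [inv_smul_smul₀ (hc0 s)] using (D s).topologicalClosure.smul_mem (c s)⁻¹ h4
  filter_upwards [ae_all_iff.2 key] with s hs
  refine dense_closure.1 ((TopologicalSpace.denseRange_denseSeq H).mono ?_)
  rintro _ ⟨n, rfl⟩
  exact hs n

variable [SigmaFinite μ] [CompleteSpace H] [TopologicalSpace.SeparableSpace H]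

/-- Norm inequalities between decomposable operators hold fibrewise. -/
theorem Decomposes.ae_norm_apply_le {B B' : Lp H 2 μ →L[ℂ] Lp H 2 μ} {F F' : Ω → H →L[ℂ] H}
    (hB : Decomposes B F) (hB' : Decomposes B' F') {C : ℝ} (hC : 0 ≤ C)
    (h : ∀ x, ‖B x‖ ≤ C * ‖B' x‖) : ∀ᵐ s ∂μ, ∀ y, ‖F s y‖ ≤ C * ‖F' s y‖ := by
  have hcomm : ∀ {B : Lp H 2 μ →L[ℂ] Lp H 2 μ} {F : Ω → H →L[ℂ] H}, Decomposes B F →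
      ∀ {E : Set Ω} {P : Lp H 2 μ →L[ℂ] Lp H 2 μ}, Decomposes P (E.indicator fun _ => 1) →
      ∀ x, P (B x) = B (P x) := by
    intro B F hB E P hP x
    ext1
    filter_upwards [(hP.comp hB) x, (hB.comp hP) x] with s h1 h2
    rw [ContinuousLinearMap.comp_apply] at h1 h2
    rw [h1, h2]
    by_cases hs : s ∈ E <;> simp [hs]
  obtain ⟨c, hc0, hc⟩ := exists_weight_memLp μ H
  have key : ∀ n, ∀ᵐ s ∂μ, ‖F s (TopologicalSpace.denseSeq H n)‖ ≤
      C * ‖F' s (TopologicalSpace.denseSeq H n)‖ := by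
    intro n
    set x := (hc (TopologicalSpace.denseSeq H n)).toLp
    have hloc := ae_norm_le_of_forall_indicator (X := B x) (Y := B' x) hC fun E _ P hP => by
      rw [hcomm hB hP, hcomm hB' hP]
      exact h _
    filter_upwards [hloc, hB x, hB' x, (hc (TopologicalSpace.denseSeq H n)).coeFn_toLp]
      with s h1 h2 h3 h4
    rw [h2, h3, h4, map_smul, map_smul, norm_smul, norm_smul, mul_left_comm] at h1
    exact le_of_mul_le_mul_left h1 (norm_pos_iff.2 (hc0 s))
  filter_upwards [ae_all_iff.2 key] with s hs y
  exact (TopologicalSpace.denseRange_denseSeq H).induction_on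
    (p := fun y => ‖F s y‖ ≤ C * ‖F' s y‖) y (isClosed_le (by fun_prop) (by fun_prop)) hs

theorem Decomposes.ae_eq {B : Lp H 2 μ →L[ℂ] Lp H 2 μ} {F F' : Ω → H →L[ℂ] H}
    (hB : Decomposes B F) (hB' : Decomposes B F') : ∀ᵐ s ∂μ, F s = F' s := by
  filter_upwards [(hB.sub hB').ae_norm_apply_le Decomposes.one le_rfl fun x => by simp] with s hs
  ext y
  simpa [sub_eq_zero] using hs y

/-- A bounded operator commuting with multiplication by indicators is decomposable. -/
theorem exists_decomposes_of_comm {S : Lp H 2 μ →L[ℂ] Lp H 2 μ} {C : ℝ} (hS : ‖S‖ ≤ C)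
    (hcomm : ∀ E, MeasurableSet E → ∀ P : Lp H 2 μ →L[ℂ] Lp H 2 μ,
      Decomposes P (E.indicator fun _ => 1) → ∀ x, S (P x) = P (S x)) :
    ∃ F : Ω → H →L[ℂ] H, (∀ᵐ s ∂μ, ‖F s‖ ≤ C) ∧ Decomposes S F := by
  have hC : 0 ≤ C := (norm_nonneg _).trans hS
  have hloc : ∀ x : Lp H 2 μ, ∀ᵐ s ∂μ, ‖S x s‖ ≤ C * ‖x s‖ := fun x =>
    ae_norm_le_of_forall_indicator hC fun E hE P hP => by
      rw [← hcomm E hE P hP]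
      exact S.le_of_opNorm_le hS _
  obtain ⟨c, hc0, hc⟩ := exists_weight_memLp μ H
  set d := TopologicalSpace.denseSeq H
  have hd : DenseRange d := TopologicalSpace.denseRange_denseSeq H
  set q := TopologicalSpace.denseSeq ℂ
  have hq : DenseRange q := TopologicalSpace.denseRange_denseSeq ℂ
  set e : ℕ → Lp H 2 μ := fun n => (hc (d n)).toLp
  have he : ∀ᵐ s ∂μ, ∀ n, e n s = c s • d n := ae_all_iff.2 fun n => (hc (d n)).coeFn_toLp
  have hex : ∀ᵐ s ∂μ, ∃ G : H →L[ℂ] H, ‖G‖ ≤ C ∧ ∀ n, G (d n) = (c s)⁻¹ • S (e n) s := by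
    have hall : ∀ᵐ s ∂μ, ∀ i j k m, ‖S (e i) s + q m • S (e j) s - S (e k) s‖ ≤
        C * ‖e i s + q m • e j s - e k s‖ := by
      simp only [ae_all_iff]
      intro i j k m
      have e1 := hloc (e i + q m • e j - e k)
      simp only [map_sub, map_add, map_smul] at e1
      filter_upwards [e1, Lp.coeFn_sub (e i + q m • e j) (e k), Lp.coeFn_add (e i) (q m • e j),
        Lp.coeFn_smul (q m) (e j), Lp.coeFn_sub (S (e i) + q m • S (e j)) (S (e k)),
        Lp.coeFn_add (S (e i)) (q m • S (e j)), Lp.coeFn_smul (q m) (S (e j))]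
        with s h0 h1 h2 h3 h4 h5 h6
      rwa [h4, Pi.sub_apply, h5, Pi.add_apply, h6, Pi.smul_apply, h1, Pi.sub_apply, h2,
        Pi.add_apply, h3, Pi.smul_apply] at h0
    filter_upwards [hall, he] with s hs hes
    refine exists_clm_of_dense hd hq hC fun i j k m => ?_
    have h1 : (c s)⁻¹ • S (e i) s + q m • (c s)⁻¹ • S (e j) s - (c s)⁻¹ • S (e k) s =
        (c s)⁻¹ • (S (e i) s + q m • S (e j) s - S (e k) s) := by
      rw [smul_sub, smul_add, smul_comm (q m)]
    have h2 : e i s + q m • e j s - e k s = c s • (d i + q m • d j - d k) := by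
      rw [hes, hes, hes, smul_sub, smul_add, smul_comm (q m)]
    have h3 := hs i j k m
    rw [h2, norm_smul, mul_left_comm] at h3
    rw [h1, norm_smul, norm_inv, inv_mul_le_iff₀ (norm_pos_iff.2 (hc0 s))]
    exact h3
  set F : Ω → H →L[ℂ] H := fun s => Classical.epsilon fun G : H →L[ℂ] H =>
    ‖G‖ ≤ C ∧ ∀ n, G (d n) = (c s)⁻¹ • S (e n) s
  have hF : ∀ᵐ s ∂μ, ‖F s‖ ≤ C ∧ ∀ n, F s (d n) = (c s)⁻¹ • S (e n) s :=
    hex.mono fun s hs => Classical.epsilon_spec hs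
  refine ⟨F, hF.mono fun s hs => hs.1, fun x => ?_⟩
  have hall : ∀ᵐ s ∂μ, ∀ n, ‖S x s - S (e n) s‖ ≤ C * ‖x s - e n s‖ := by
    rw [ae_all_iff]
    intro n
    have e1 := hloc (x - e n)
    rw [map_sub] at e1
    filter_upwards [e1, Lp.coeFn_sub x (e n), Lp.coeFn_sub (S x) (S (e n))] with s h0 h1 h2
    rwa [h1, h2, Pi.sub_apply, Pi.sub_apply] at h0
  filter_upwards [hall, he, hF] with s hs hes hFs
  have h1 : ∀ h : H, ‖S x s - F s (c s • h)‖ ≤ C * ‖x s - c s • h‖ := fun h =>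
    hd.induction_on (p := fun h => ‖S x s - F s (c s • h)‖ ≤ C * ‖x s - c s • h‖) h
      (isClosed_le (by fun_prop) (by fun_prop)) fun n => by
        rw [map_smul, hFs.2, smul_inv_smul₀ (hc0 s), ← hes]
        exact hs n
  simpa [smul_inv_smul₀ (hc0 s), sub_eq_zero] using h1 ((c s)⁻¹ • x s)

end Decomposes

section Resolvent

variable {K : Type*} [NormedAddCommGroup K] [NormedSpace ℂ K] {A : K →ₗ.[ℂ] K} {ν : ℂ}
  {R : K →L[ℂ] K}

theorem ResolventAt.mem_graph (hR : ResolventAt A ν R) (y : K) :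
    (R y, ν • R y - y) ∈ A.graph := by
  obtain ⟨hy, h⟩ := hR.1 y
  have e : A ⟨R y, hy⟩ = ν • R y - y := by
    nth_rw 3 [← h]
    abel
  exact e ▸ A.mem_graph ⟨R y, hy⟩

theorem ResolventAt.apply_smul_sub (hR : ResolventAt A ν R) {x y : K} (h : (x, y) ∈ A.graph) :
    R (ν • x - y) = x := by
  obtain ⟨z, rfl, rfl⟩ := (LinearPMap.mem_graph_iff A).1 h
  exact hR.2 z

theorem ResolventAt.apply_mem_graph (hR : ResolventAt A ν R) {x y : K} (h : (x, y) ∈ A.graph) :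
    (R x, R y) ∈ A.graph := by
  have e : R y = ν • R x - x := by
    nth_rw 2 [← hR.apply_smul_sub h]
    rw [map_sub, map_smul]
    abel
  exact e ▸ hR.mem_graph x

end Resolvent

variable {Ω : Type*} [MeasurableSpace Ω] {μ : Measure Ω} [SigmaFinite μ]
variable {H : Type*} [NormedAddCommGroup H] [InnerProductSpace ℂ H] [CompleteSpace H]
  [TopologicalSpace.SeparableSpace H]

/-- If the decomposable operator `𝒜` generates a `C₀`-semigroup `𝒯` with
`‖𝒯 t‖ ≤ M e^{ω t}`, then for a.e. `s` the fibre operator `A s` generates a `C₀`-semigroup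
`T s` with the same bound, and `𝒯 t` is the multiplication operator by `s ↦ T s t`. -/
theorem decomposable_generator_decomposes
    (ν : ℂ) (R : Ω → H →L[ℂ] H)
    (hmeasR : ∀ x : H, StronglyMeasurable fun s => R s x)
    (hbddR : ∃ C : ℝ, ∀ᵐ s ∂μ, ‖R s‖ ≤ C)
    (hinj : ∀ᵐ s ∂μ, Function.Injective (R s))
    (As : Ω → H →ₗ.[ℂ] H)
    (hres : ∀ᵐ s ∂μ, ResolventAt (As s) ν (R s))
    (𝒜 : Lp H 2 μ →ₗ.[ℂ] Lp H 2 μ)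
    (h𝒜dom : ∀ x : Lp H 2 μ,
      x ∈ 𝒜.domain ↔ ∃ g : Lp H 2 μ, ∀ᵐ s ∂μ, (x s, g s) ∈ (As s).graph)
    (h𝒜val : ∀ x : 𝒜.domain, ∀ᵐ s ∂μ, ((x : Lp H 2 μ) s, (𝒜 x) s) ∈ (As s).graph)
    (𝒯 : ℝ → Lp H 2 μ →L[ℂ] Lp H 2 μ)
    (h𝒯sg : IsC0Semigroup 𝒯) (h𝒯gen : IsGenerator 𝒯 𝒜)
    (M ω : ℝ) (hM : 1 ≤ M)
    (hbound : ∀ t : ℝ, 0 ≤ t → ‖𝒯 t‖ ≤ M * Real.exp (ω * t)) :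
    ∃ T : Ω → ℝ → H →L[ℂ] H,
      (∀ᵐ s ∂μ, IsC0Semigroup (T s) ∧ IsGenerator (T s) (As s) ∧
        ∀ t : ℝ, 0 ≤ t → ‖T s t‖ ≤ M * Real.exp (ω * t)) ∧
      ∀ t : ℝ, 0 ≤ t → ∀ x : Lp H 2 μ, ⇑(𝒯 t x) =ᵐ[μ] fun s => T s t (x s) := by
  have hM0 : 0 ≤ M := zero_le_one.trans hM
  obtain ⟨C, hC⟩ := hbddR
  obtain ⟨B, hB⟩ := exists_decomposes hmeasR hC
  have hgraph : ∀ x g : Lp H 2 μ, (x, g) ∈ 𝒜.graph ↔ ∀ᵐ s ∂μ, (x s, g s) ∈ (As s).graph := by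
    refine fun x g => ⟨fun h => ?_, fun h => ?_⟩
    · obtain ⟨z, rfl, rfl⟩ := (LinearPMap.mem_graph_iff 𝒜).1 h
      exact h𝒜val z
    · have hx : x ∈ 𝒜.domain := (h𝒜dom x).2 ⟨g, h⟩
      have e : 𝒜 ⟨x, hx⟩ = g := by
        ext1
        filter_upwards [h, h𝒜val ⟨x, hx⟩] with s h1 h2
        exact (As s).mem_graph_snd_inj h2 h1 rfl
      exact e ▸ 𝒜.mem_graph ⟨x, hx⟩
  have hBgraph : ∀ x, (B x, ν • B x - x) ∈ 𝒜.graph := by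
    intro x
    rw [hgraph]
    filter_upwards [hres, hB x, Lp.coeFn_sub (ν • B x) x, Lp.coeFn_smul ν (B x)]
      with s h0 h1 h2 h3
    rw [h2, Pi.sub_apply, h3, Pi.smul_apply, h1]
    exact h0.mem_graph (x s)
  have hBcomm : ∀ t : ℝ, 0 ≤ t → ∀ x, 𝒯 t (B x) = B (𝒯 t x) := fun t ht x =>
    h𝒯sg.apply_comm h𝒯gen hM0 hbound B (fun x g h => by
      rw [hgraph] at h ⊢
      filter_upwards [h, hres, hB x, hB g] with s h0 h1 h2 h3
      rw [h2, h3]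
      exact h1.apply_mem_graph h0) ht x
  have hdec : ∀ q : ℚ≥0, ∃ F : Ω → H →L[ℂ] H,
      (∀ᵐ s ∂μ, ‖F s‖ ≤ M * Real.exp (ω * q)) ∧ Decomposes (𝒯 q) F := fun q =>
    exists_decomposes_of_comm (hbound q (by positivity)) fun E _ P hP x =>
      h𝒯sg.apply_comm h𝒯gen hM0 hbound P (fun x g h => by
        rw [hgraph] at h ⊢
        filter_upwards [h, hP x, hP g] with s h0 h1 h2
        rw [h1, h2]
        by_cases hs : s ∈ E
        · simpa [hs] using h0
        · simp [hs]) (by positivity) x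
  choose F hFnorm hF using hdec
  have hF0 : ∀ᵐ s ∂μ, F 0 s = 1 := by
    have h := hF 0
    rw [NNRat.cast_zero, h𝒯sg.1] at h
    exact h.ae_eq Decomposes.one
  have hFadd : ∀ p q, ∀ᵐ s ∂μ, F (p + q) s = (F p s).comp (F q s) := fun p q => by
    have h := hF (p + q)
    rw [NNRat.cast_add, h𝒯sg.2.1 p q (by positivity) (by positivity)] at h
    exact h.ae_eq ((hF p).comp (hF q))
  have hFcomm : ∀ q, ∀ᵐ s ∂μ, (F q s).comp (R s) = (R s).comp (F q s) := fun q => by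
    have h := (hF q).comp hB
    have e : (𝒯 q).comp B = B.comp (𝒯 q) := by
      ext1 x
      exact hBcomm q (by positivity) x
    rw [e] at h
    exact h.ae_eq (hB.comp (hF q)) |>.mono fun s hs => hs
  have hF1 : ∀ q : ℚ≥0, ∀ᵐ s ∂μ, ∀ h, ‖F q s (R s h) - R s h‖ ≤
      M * Real.exp (|ω| * q) * q * ‖ν • R s h - h‖ := fun q =>
    (((hF q).comp hB).sub hB).ae_norm_apply_le ((hB.smul ν).sub .one)
      (C := M * Real.exp (|ω| * q) * q) (by positivity) fun x =>
      h𝒯sg.norm_sub_le h𝒯gen hM0 hbound (hBgraph x) (by positivity)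
  have hF2 : ∀ q : ℚ≥0, ∀ᵐ s ∂μ, ∀ h,
      ‖F q s (R s (R s h)) - R s (R s h) - (q : ℝ) • (ν • R s (R s h) - R s h)‖ ≤
      M * Real.exp (|ω| * q) * q * q * ‖ν • (ν • R s (R s h) - R s h) - (ν • R s h - h)‖ :=
    fun q => by
    have hBB := hB.comp hB
    have h := ((((hF q).comp hBB).sub hBB).sub
      ((((hBB.smul ν).sub hB)).smul ((q : ℝ) : ℂ))).ae_norm_apply_le
      ((((hBB.smul ν).sub hB).smul ν).sub ((hB.smul ν).sub .one))
      (C := M * Real.exp (|ω| * q) * q * q) (by positivity) fun x => by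
        have h2 : (ν • B (B x) - B x, ν • (ν • B (B x) - B x) - (ν • B x - x)) ∈ 𝒜.graph :=
          𝒜.graph.sub_mem (𝒜.graph.smul_mem ν (hBgraph (B x))) (hBgraph x)
        exact h𝒯sg.norm_sub_sub_smul_le h𝒯gen hM0 hbound (hBgraph (B x)) h2 (by positivity)
    exact h
  have hdense : ∀ᵐ s ∂μ, DenseRange (R s) := by
    refine ae_dense_of_dense (D := fun s => (R s).range) (h𝒯sg.dense_domain h𝒯gen) fun x hx => ?_
    filter_upwards [h𝒜val ⟨x, hx⟩, hres] with s h1 h2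
    exact ⟨_, h2.apply_smul_sub h1⟩
  have hex : ∀ᵐ s ∂μ, ∃ T : ℝ → H →L[ℂ] H, IsC0Semigroup T ∧ IsGenerator T (As s) ∧
      (∀ t : ℝ, 0 ≤ t → ‖T t‖ ≤ M * Real.exp (ω * t)) ∧ ∀ q : ℚ≥0, T q = F q s := by
    filter_upwards [hres, hdense, hF0, ae_all_iff.2 fun p => ae_all_iff.2 (hFadd p),
      ae_all_iff.2 hFnorm, ae_all_iff.2 hFcomm, ae_all_iff.2 hF1, ae_all_iff.2 hF2]
      with s h1 h2 h3 h4 h5 h6 h7 h8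
    exact exists_c0Semigroup_of_nnrat h1 h2 (fun q => F q s) hM0 h3 h4 h5
      (fun q h => congrArg (fun L => L h) (h6 q)) h7 h8
  set T : Ω → ℝ → H →L[ℂ] H := fun s => Classical.epsilon fun T : ℝ → H →L[ℂ] H =>
    IsC0Semigroup T ∧ IsGenerator T (As s) ∧
      (∀ t : ℝ, 0 ≤ t → ‖T t‖ ≤ M * Real.exp (ω * t)) ∧ ∀ q : ℚ≥0, T q = F q s
  have hT : ∀ᵐ s ∂μ, IsC0Semigroup (T s) ∧ IsGenerator (T s) (As s) ∧
      (∀ t : ℝ, 0 ≤ t → ‖T s t‖ ≤ M * Real.exp (ω * t)) ∧ ∀ q : ℚ≥0, T s q = F q s :=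
    hex.mono fun s hs => Classical.epsilon_spec hs
  refine ⟨T, hT.mono fun s hs => ⟨hs.1, hs.2.1, hs.2.2.1⟩, fun t ht x => ?_⟩
  obtain ⟨u, hu, hulim⟩ := mem_closure_iff_seq_limit.1 (isDenseInducing_nnratCast.dense ⟨t, ht⟩)
  choose q hq using hu
  have hqlim : Tendsto (fun n => (q n : ℝ)) atTop (𝓝[Ici 0] t) := by
    refine tendsto_nhdsWithin_iff.2 ⟨?_, Eventually.of_forall fun n => mem_Ici.2 (by positivity)⟩
    refine ((NNReal.continuous_coe.tendsto _).comp hulim).congr fun n => ?_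
    rw [Function.comp_apply, ← hq n, coe_nnratCast_nnreal]
  have hlim : Tendsto (fun n => 𝒯 (q n) x) atTop (𝓝 (𝒯 t x)) :=
    (h𝒯sg.2.2 x t ht).tendsto.comp hqlim
  obtain ⟨ns, hns, hae⟩ := (tendstoInMeasure_of_tendsto_Lp hlim).exists_seq_tendsto_ae
  filter_upwards [hae, hT, ae_all_iff.2 fun n => hF (q n) x] with s h1 h2 h3
  refine tendsto_nhds_unique h1 ?_
  refine ((h2.1.2.2 (x s) t ht).tendsto.comp (hqlim.comp hns.tendsto_atTop)).congr fun n => ?_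
  rw [h3, ← h2.2.2.2]
  rfl
end
end
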